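/- For every nonnegative integer $n$, $\operatorname{spt}(7n+5) \equiv 0 \pmod 7$. -/

import Mathlib

/-- The smallest parts function. -/
def spt (n : ℕ) : ℕ :=
  ∑ P : Nat.Partition n, Multiset.card (P.parts.filter (fun a => ∀ b ∈ P.parts, a ≤ b))


namespace SptSeven

open PowerSeries Filter Topology
open scoped PowerSeries.WithPiTopology

/-! ### Basic tools -/

lemma summ {ι : Type*} (f : ι → ℤ⟦X⟧) (w : ι → ℕ) (hw : ∀ N, {i | w i ≤ N}.Finite)
    (h : ∀ i, X ^ (w i) ∣ f i) : Summable f := by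
  rw [PowerSeries.WithPiTopology.summable_iff_summable_coeff]
  intro d
  refine summable_of_hasFiniteSupport <| (hw d).subset ?_
  intro i hi
  by_contra hc
  simp only [Set.mem_ofPred_eq, not_le] at hc
  exact hi (X_pow_dvd_iff.1 (h i) d hc)

lemma summN (f : ℕ → ℤ⟦X⟧) (h : ∀ i, X ^ i ∣ f i) : Summable f :=
  summ f id (fun N => Set.finite_Iic N) h

lemma finZ (c N : ℕ) : {i : ℤ | i.natAbs - c ≤ N}.Finite := by
  refine (Set.finite_Icc (-(c + N : ℤ)) (c + N)).subset ?_
  intro i hi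
  simp only [Set.mem_ofPred_eq] at hi
  simp only [Set.mem_Icc]
  omega

lemma summZ (c : ℕ) (f : ℤ → ℤ⟦X⟧) (h : ∀ i, X ^ (i.natAbs - c) ∣ f i) : Summable f :=
  summ f (fun i => i.natAbs - c) (finZ c) h

lemma coeff_tsum {ι : Type*} {f : ι → ℤ⟦X⟧} (hf : Summable f) (d : ℕ) :
    coeff d (∑' i, f i) = ∑' i, coeff d (f i) := by
  have := (PowerSeries.WithPiTopology.hasSum_iff_hasSum_coeff ℤ).1 hf.hasSum d
  exact this.tsum_eq.symm

lemma dvd_tsum {ι : Type*} {f : ι → ℤ⟦X⟧} {n : ℕ} (h : ∀ i, X ^ n ∣ f i) :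
    X ^ n ∣ ∑' i, f i := by
  by_cases hf : Summable f
  · rw [X_pow_dvd_iff]
    intro m hm
    rw [coeff_tsum hf]
    simp [fun i => X_pow_dvd_iff.1 (h i) m hm]
  · rw [tsum_eq_zero_of_not_summable hf]; exact dvd_zero _

/-- The operator `q d/dq`. -/
noncomputable def D (f : ℤ⟦X⟧) : ℤ⟦X⟧ := X * d⁄dX ℤ f

lemma coeff_D (f : ℤ⟦X⟧) (n : ℕ) : coeff n (D f) = n * coeff n f := by
  unfold D
  cases n with
  | zero => simp
  | succ n => rw [coeff_succ_X_mul, coeff_derivative]; push_cast; ring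

lemma D_add (f g : ℤ⟦X⟧) : D (f + g) = D f + D g := by simp [D, mul_add]

lemma D_sub (f g : ℤ⟦X⟧) : D (f - g) = D f - D g := by simp [D, mul_sub]

lemma D_mul (f g : ℤ⟦X⟧) : D (f * g) = f * D g + g * D f := by
  simp only [D, Derivation.leibniz, smul_eq_mul]; ring

lemma D_one : D 1 = 0 := by simp [D]

lemma D_int (c : ℤ) : D (c : ℤ⟦X⟧) = 0 := by
  simp [D]

lemma D_intmul (c : ℤ) (f : ℤ⟦X⟧) : D (c * f) = c * D f := by
  rw [D_mul, D_int]; ring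

lemma D_X_pow (n : ℕ) : D ((X : ℤ⟦X⟧) ^ n) = (n : ℤ⟦X⟧) * X ^ n := by
  ext d
  rw [coeff_D, ← map_natCast (C (R := ℤ)), coeff_C_mul, coeff_X_pow]
  split_ifs with h
  · rw [h]
  · simp

/-- `D` as an additive map. -/
noncomputable def DH : ℤ⟦X⟧ →+ ℤ⟦X⟧ where
  toFun := D
  map_zero' := by simp [D]
  map_add' := D_add

lemma cont_D : Continuous D := by
  rw [continuous_iff_continuousAt]
  intro f
  rw [ContinuousAt, PowerSeries.WithPiTopology.tendsto_iff_coeff_tendsto]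
  intro d
  simp only [coeff_D]
  exact ((PowerSeries.WithPiTopology.continuous_coeff ℤ d).tendsto f).const_mul _

lemma hasSum_D {ι : Type*} {f : ι → ℤ⟦X⟧} {a : ℤ⟦X⟧} (h : HasSum f a) :
    HasSum (fun i => D (f i)) (D a) :=
  h.map DH cont_D

/-- `1/(1-q^t)`. -/
noncomputable def K (t : ℕ) : ℤ⟦X⟧ := invOfUnit (1 - X ^ t) 1

lemma K_mul {t : ℕ} (ht : t ≠ 0) : (1 - X ^ t) * K t = 1 := by
  apply mul_invOfUnit
  simp [ht]

/-- `q^t/(1-q^t)`. -/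
noncomputable def E (t : ℕ) : ℤ⟦X⟧ := X ^ t * K t

lemma K_eq {t : ℕ} (ht : t ≠ 0) : K t = 1 + E t := by
  have := K_mul ht
  unfold E; linear_combination this

lemma E_dvd (t : ℕ) : X ^ t ∣ E t := Dvd.intro _ rfl

lemma E_tsum {t : ℕ} (ht : t ≠ 0) : HasSum (fun x : ℕ => (X : ℤ⟦X⟧) ^ (t * (x + 1))) (E t) := by
  have h0 : constantCoeff (X ^ t : ℤ⟦X⟧) = 0 := by simp [ht]
  have hs := PowerSeries.WithPiTopology.summable_pow_of_constantCoeff_eq_zero h0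
  have h1 := PowerSeries.WithPiTopology.one_sub_mul_tsum_pow_of_constantCoeff_eq_zero h0
  have h2 : K t = ∑' i : ℕ, (X ^ t : ℤ⟦X⟧) ^ i := by
    have := K_mul ht
    calc K t = ((1 - X ^ t) * K t) * ∑' i : ℕ, (X ^ t : ℤ⟦X⟧) ^ i := by
          rw [mul_comm _ (K t), mul_assoc, h1, mul_one]
      _ = _ := by rw [this, one_mul]
  have h3 := (hs.hasSum).mul_left (X ^ t)
  rw [← h2] at h3
  have h4 : (fun x : ℕ => (X : ℤ⟦X⟧) ^ (t * (x + 1))) = fun i => X ^ t * (X ^ t) ^ i := by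
    funext x
    rw [← pow_mul]; ring
  rw [h4]
  exact h3

/-- `Σ σ_i(n) q^n`. -/
noncomputable def Φ (i : ℕ) : ℤ⟦X⟧ := ∑' t : ℕ, ((t + 1 : ℕ) : ℤ⟦X⟧) ^ i * E (t + 1)

lemma Φ_summable (i : ℕ) : Summable fun t : ℕ => ((t + 1 : ℕ) : ℤ⟦X⟧) ^ i * E (t + 1) :=
  summN _ fun t => ((pow_dvd_pow _ (by omega)).trans (E_dvd (t + 1))).mul_left _

/-- Euler's function. -/
noncomputable def e : ℤ⟦X⟧ := pentagonalSeries ℤ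

lemma tendsto_prod_e : Tendsto (fun n => ∏ i ∈ Finset.range n, (1 - X ^ (i + 1) : ℤ⟦X⟧)) atTop (𝓝 e) :=
  (PowerSeries.WithPiTopology.hasProd_one_sub_X_pow ℤ).tendsto_prod_nat

lemma D_prod (n : ℕ) : D (∏ i ∈ Finset.range n, (1 - X ^ (i + 1) : ℤ⟦X⟧)) =
    -(∑ i ∈ Finset.range n, ((i + 1 : ℕ) : ℤ⟦X⟧) ^ 1 * E (i + 1)) *
      ∏ i ∈ Finset.range n, (1 - X ^ (i + 1) : ℤ⟦X⟧) := by
  induction n with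
  | zero => simp [D_one]
  | succ n ih =>
    rw [Finset.prod_range_succ, D_mul, ih, Finset.sum_range_succ, D_sub, D_one, D_X_pow]
    have := K_mul (Nat.succ_ne_zero n)
    unfold E
    rw [Nat.succ_eq_add_one] at this
    linear_combination (-(∏ i ∈ Finset.range n, (1 - X ^ (i + 1) : ℤ⟦X⟧)) * ((n + 1 : ℕ) : ℤ⟦X⟧) * X ^ (n + 1)) * (-this)

lemma D_e : D e = -Φ 1 * e := by
  have h1 := (cont_D.tendsto e).comp tendsto_prod_e
  have h2 : Tendsto (D ∘ fun n => ∏ i ∈ Finset.range n, (1 - X ^ (i + 1) : ℤ⟦X⟧)) atTop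
      (𝓝 (-Φ 1 * e)) := by
    have : (D ∘ fun n => ∏ i ∈ Finset.range n, (1 - X ^ (i + 1) : ℤ⟦X⟧)) = fun n =>
      -(∑ i ∈ Finset.range n, ((i + 1 : ℕ) : ℤ⟦X⟧) ^ 1 * E (i + 1)) *
      ∏ i ∈ Finset.range n, (1 - X ^ (i + 1) : ℤ⟦X⟧) := by
      funext n; exact D_prod n
    rw [this]
    exact ((Φ_summable 1).hasSum.tendsto_sum_nat.neg).mul tendsto_prod_e
  exact tendsto_nhds_unique h1 h2

/-- triangular numbers -/
def T (m : ℤ) : ℤ := m * (m - 1) / 2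

lemma two_T (m : ℤ) : 2 * T m = m * (m - 1) := by
  unfold T
  apply Int.mul_ediv_cancel'
  have := Int.even_mul_pred_self m
  exact this.two_dvd

end SptSeven


namespace SptSeven

open PowerSeries Filter Topology
open scoped PowerSeries.WithPiTopology

/-! ### The sequence `L` -/

/-- basic terms -/
noncomputable def lt (n k : ℕ) : ℤ⟦X⟧ :=
  (-1) ^ n * X ^ (pentagonal n + n * k) * (3 * Φ 1 + ((T (3 * n + k) : ℤ) : ℤ⟦X⟧))

/-- half sums -/
noncomputable def H (k : ℕ) : ℤ⟦X⟧ := ∑' n : ℕ, lt (n + 1) k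

/-- main term -/
noncomputable def pp (k : ℤ) : ℤ⟦X⟧ := 3 * Φ 1 + ((T k : ℤ) : ℤ⟦X⟧)

/-- the sequence `L` -/
noncomputable def L : ℤ → ℤ⟦X⟧
  | Int.ofNat k => pp k + H k
  | Int.negSucc j => -H (j + 2)

lemma L_nat (k : ℕ) : L (k : ℤ) = pp k + H k := rfl
lemma L_neg (j : ℕ) : L (-(j : ℤ) - 1) = -H (j + 2) := by
  have : -(j : ℤ) - 1 = Int.negSucc j := by omega
  rw [this]; rfl

lemma two_pent (n : ℕ) : 2 * (pentagonal (n : ℤ) : ℤ) = n * (3 * n - 1) := two_mul_natCast_pentagonal n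

lemma pent_ge (n : ℕ) : n ≤ pentagonal (n : ℤ) := by
  have := two_pent n
  zify
  rcases n with _ | n
  · simp
  · push_cast at *
    nlinarith

lemma pent_succ (n : ℕ) : pentagonal ((n + 1 : ℕ) : ℤ) = pentagonal (n : ℤ) + 3 * n + 1 := by
  have h1 := two_pent n
  have h2 := two_pent (n + 1)
  zify
  push_cast at *
  nlinarith

lemma lt_dvd (n k : ℕ) : X ^ (n * (k + 1)) ∣ lt n k := by
  unfold lt
  refine Dvd.dvd.mul_right (Dvd.dvd.mul_left (pow_dvd_pow _ ?_) _) _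
  have := pent_ge n
  linarith

lemma lt_summable (k : ℕ) : Summable fun n => lt n k :=
  summN _ fun n => (pow_dvd_pow _ (by nlinarith)).trans (lt_dvd n k)

lemma lt_summable' (k : ℕ) : Summable fun n => lt (n + 1) k :=
  (summable_nat_add_iff 1).2 (lt_summable k)

lemma H_dvd (k : ℕ) : X ^ (k + 1) ∣ H k :=
  dvd_tsum fun n => (pow_dvd_pow _ (by nlinarith)).trans (lt_dvd (n + 1) k)

lemma lt_zero (k : ℕ) : lt 0 k = pp k := by simp [lt, pp, pentagonal_def]

lemma lt_succ (n k : ℕ) : lt (n + 1) k = -X ^ (k + 1) * lt n (k + 3) := by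
  unfold lt
  have h1 : (3 * ((n + 1 : ℕ) : ℤ) + (k : ℤ)) = 3 * (n : ℤ) + ((k + 3 : ℕ) : ℤ) := by
    push_cast; ring
  rw [h1, pent_succ]
  have h2 : pentagonal (n : ℤ) + 3 * n + 1 + (n + 1) * k = (k + 1) + (pentagonal (n : ℤ) + n * (k + 3)) := by
    ring
  rw [h2, pow_add X (k + 1), pow_succ (-1 : ℤ⟦X⟧) n]
  ring

lemma H_rec (k : ℕ) : H k = -X ^ (k + 1) * (pp (k + 3 : ℕ) + H (k + 3)) := by
  unfold H
  simp_rw [lt_succ _ k]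
  rw [(lt_summable (k + 3)).tsum_mul_left, (lt_summable (k + 3)).tsum_eq_zero_add, lt_zero]

lemma T_sym (k : ℤ) : T (1 - k) = T k := by
  have h1 := two_T k
  have h2 := two_T (1 - k)
  linarith

lemma pp_sym (k : ℤ) : pp (1 - k) = pp k := by unfold pp; rw [T_sym]

lemma T_pent (n : ℕ) : T (3 * n) = 3 * (pentagonal (n : ℤ) : ℤ) := by
  have h1 := two_T (3 * n)
  have h2 := two_pent n
  linarith

lemma T_pent' (n : ℕ) : T (3 * n + 1) = 3 * (pentagonal (-(n : ℤ)) : ℤ) := by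
  have h1 := two_T (3 * n + 1)
  have h2 := two_mul_natCast_pentagonal_neg n
  linarith

lemma pent_neg (n : ℕ) : pentagonal (-(n : ℤ)) = pentagonal (n : ℤ) + n := by
  have h1 := two_pent n
  have h2 := two_mul_natCast_pentagonal_neg n
  zify
  linarith

lemma V_zero : H 0 + H 1 + 3 * Φ 1 = 0 := by
  have h1 := PowerSeries.WithPiTopology.hasSum_pow_pentagonal_sub_pentagonalSeries ℤ
  change HasSum _ e at h1
  have h2 := ((hasSum_D h1).add (h1.mul_left (Φ 1))).mul_left 3
  have h3 : D e + Φ 1 * e = 0 := by rw [D_e]; ring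
  rw [h3, mul_zero] at h2
  have h4 : HasSum (fun n : ℕ => lt n 1 + lt (n + 1) 0) (3 * Φ 1 + H 1 + H 0) := by
    have a1 := (lt_summable 1).hasSum
    rw [(lt_summable 1).tsum_eq_zero_add, lt_zero] at a1
    have a2 := a1.add (lt_summable' 0).hasSum
    have a3 : pp (1 : ℕ) = 3 * Φ 1 := by simp [pp, T]
    rw [a3] at a2
    exact a2
  have h5 : (fun n : ℕ => lt n 1 + lt (n + 1) 0) = fun k : ℕ => 3 *
     (D ((-1) ^ k * (X ^ pentagonal (-k) - X ^ pentagonal (k + 1))) +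
        Φ 1 * ((-1) ^ k * (X ^ pentagonal (-k) - X ^ pentagonal (k + 1)))) := by
    funext n
    have hc : ((-1 : ℤ⟦X⟧) ^ n) = (((-1) ^ n : ℤ) : ℤ⟦X⟧) := by push_cast; rfl
    rw [hc, D_intmul, D_sub, D_X_pow, D_X_pow, ← hc]
    unfold lt
    have e1 := T_pent (n + 1)
    have e2 := T_pent' n
    have e3 : (3 * ((n + 1 : ℕ) : ℤ) + ((0 : ℕ) : ℤ)) = 3 * ((n + 1 : ℕ) : ℤ) := by push_cast; ring
    rw [e3, e1, Nat.cast_one, e2, mul_zero, add_zero, mul_one, ← pent_neg n]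
    push_cast
    ring
  rw [h5] at h4
  have := h4.unique h2
  linear_combination this

lemma L_rec (k : ℤ) (a b : ℕ) (h : (b : ℤ) = a + (k - 2)) :
    X ^ a * L (k - 3) + X ^ b * L k = X ^ a * pp (k - 3) := by
  by_cases h3 : 3 ≤ k
  · obtain ⟨j, rfl⟩ : ∃ j : ℕ, k = ((j + 3 : ℕ) : ℤ) := ⟨(k - 3).toNat, by push_cast; omega⟩
    have hb : b = a + (j + 1) := by push_cast at h; omega
    have e1 : ((j + 3 : ℕ) : ℤ) - 3 = (j : ℕ) := by push_cast; ring
    rw [e1, L_nat, L_nat, hb, pow_add]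
    have := H_rec j
    linear_combination (X : ℤ⟦X⟧) ^ a * this
  by_cases h0 : k < 0
  · obtain ⟨j, rfl⟩ : ∃ j : ℕ, k = -(j : ℤ) - 1 := ⟨(-k - 1).toNat, by omega⟩
    have ha : a = b + (j + 3) := by omega
    have e1 : -(j : ℤ) - 1 - 3 = -((j + 3 : ℕ) : ℤ) - 1 := by push_cast; ring
    rw [e1, L_neg, L_neg, ha, pow_add]
    have h1 := H_rec (j + 2)
    have h2 := pp_sym ((j + 2 + 3 : ℕ) : ℤ)
    have e2 : 1 - ((j + 2 + 3 : ℕ) : ℤ) = -((j + 3 : ℕ) : ℤ) - 1 := by push_cast; ring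
    rw [e2] at h2
    rw [h2]
    linear_combination -(X : ℤ⟦X⟧) ^ b * h1
  have hV := V_zero
  obtain rfl | rfl | rfl : k = 0 ∨ k = 1 ∨ k = 2 := by omega
  · have ha : a = b + 2 := by omega
    have e1 : (0 : ℤ) - 3 = -((2 : ℕ) : ℤ) - 1 := by norm_num
    have h1 := H_rec 1
    have h2 := pp_sym ((1 + 3 : ℕ) : ℤ)
    have e2 : 1 - ((1 + 3 : ℕ) : ℤ) = -((2 : ℕ) : ℤ) - 1 := by norm_num
    rw [e2] at h2
    have e3 : L 0 = pp 0 + H 0 := L_nat 0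
    have e4 : pp 0 = 3 * Φ 1 := by simp [pp, T]
    rw [e1, L_neg, e3, h2, ha, e4, pow_add]
    linear_combination -(X : ℤ⟦X⟧) ^ b * h1 + X ^ b * hV
  · have ha : a = b + 1 := by omega
    have e1 : (1 : ℤ) - 3 = -((1 : ℕ) : ℤ) - 1 := by norm_num
    have h1 := H_rec 0
    have h2 := pp_sym ((0 + 3 : ℕ) : ℤ)
    have e2 : 1 - ((0 + 3 : ℕ) : ℤ) = -((1 : ℕ) : ℤ) - 1 := by norm_num
    rw [e2] at h2
    have e3 : L 1 = pp 1 + H 1 := L_nat 1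
    have e4 : pp 1 = 3 * Φ 1 := by simp [pp, T]
    rw [e1, L_neg, e3, h2, ha, e4, pow_add]
    linear_combination -(X : ℤ⟦X⟧) ^ b * h1 + X ^ b * hV
  · have ha : a = b := by omega
    have e1 : (2 : ℤ) - 3 = -((0 : ℕ) : ℤ) - 1 := by norm_num
    have e3 : L 2 = pp 2 + H 2 := L_nat 2
    have h2 := pp_sym 2
    have e2 : (1 : ℤ) - 2 = -((0 : ℕ) : ℤ) - 1 := by norm_num
    rw [e2] at h2
    rw [e1, L_neg, e3, h2, ha]
    ring

lemma L_neg_dvd (k : ℤ) (n : ℕ) (h : k ≤ -(n : ℤ)) (hn : 0 < n) : X ^ n ∣ L k := by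
  obtain ⟨j, rfl⟩ : ∃ j : ℕ, k = -(j : ℤ) - 1 := ⟨(-k - 1).toNat, by omega⟩
  rw [L_neg, dvd_neg]
  exact (pow_dvd_pow _ (by omega)).trans (H_dvd (j + 2))

lemma L_pos_dvd (k : ℤ) (n : ℕ) (h : (n : ℤ) ≤ k) : X ^ n ∣ L k - pp k := by
  obtain ⟨j, rfl⟩ : ∃ j : ℕ, k = (j : ℤ) := ⟨k.toNat, by omega⟩
  rw [L_nat, add_sub_cancel_left]
  exact (pow_dvd_pow _ (by omega)).trans (H_dvd j)

end SptSeven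


namespace SptSeven

open PowerSeries Filter Topology
open scoped PowerSeries.WithPiTopology

lemma summNc (c : ℕ) (f : ℕ → ℤ⟦X⟧) (h : ∀ i, X ^ (i - c) ∣ f i) : Summable f :=
  summ f (fun i => i - c) (fun N => (Set.finite_Iic (N + c)).subset (fun i hi => by
    simp only [Set.mem_ofPred_eq] at hi
    simp only [Set.mem_Iic]; omega)) h

lemma L_sub_dvd (k : ℤ) (t : ℕ) : X ^ (t - k.natAbs) ∣ L (k - ((t + 1 : ℕ) : ℤ)) := by
  by_cases h : t ≤ k.natAbs
  · rw [Nat.sub_eq_zero_of_le h]; simp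
  · apply L_neg_dvd
    · push_cast; omega
    · omega

lemma L_add_dvd (k : ℤ) (t : ℕ) :
    X ^ (t - k.natAbs) ∣ L (k + ((t + 1 : ℕ) : ℤ)) - pp (k + ((t + 1 : ℕ) : ℤ)) := by
  by_cases h : t ≤ k.natAbs
  · rw [Nat.sub_eq_zero_of_le h]; simp
  · apply L_pos_dvd
    push_cast; omega

/-- lower sums -/
noncomputable def U (k : ℤ) : ℤ⟦X⟧ := ∑' t : ℕ, L (k - ((t + 1 : ℕ) : ℤ))

/-- upper sums -/
noncomputable def V (k : ℤ) : ℤ⟦X⟧ :=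
  ∑' t : ℕ, (L (k + ((t + 1 : ℕ) : ℤ)) - pp (k + ((t + 1 : ℕ) : ℤ)))

lemma U_summable (k : ℤ) : Summable fun t : ℕ => L (k - ((t + 1 : ℕ) : ℤ)) :=
  summNc k.natAbs _ (L_sub_dvd k)

lemma V_summable (k : ℤ) :
    Summable fun t : ℕ => (L (k + ((t + 1 : ℕ) : ℤ)) - pp (k + ((t + 1 : ℕ) : ℤ))) :=
  summNc k.natAbs _ (L_add_dvd k)

lemma U_succ (k : ℤ) : U (k + 1) = L k + U k := by
  unfold U
  rw [(U_summable (k + 1)).tsum_eq_zero_add]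
  congr 1
  · congr 1; push_cast; ring
  · apply tsum_congr; intro t; congr 1; push_cast; ring

lemma V_succ (k : ℤ) : V k = (L (k + 1) - pp (k + 1)) + V (k + 1) := by
  unfold V
  rw [(V_summable k).tsum_eq_zero_add]
  congr 1
  apply tsum_congr; intro t
  have : k + ((t + 1 + 1 : ℕ) : ℤ) = k + 1 + ((t + 1 : ℕ) : ℤ) := by push_cast; ring
  rw [this]

lemma UV_zero : L 0 + U 0 + V 0 = 0 := by
  have h1 : U 0 = -∑' t : ℕ, H (t + 2) := by
    unfold U
    rw [← tsum_neg]
    apply tsum_congr; intro t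
    rw [← L_neg]; congr 1; push_cast; ring
  have h2 : V 0 = H 1 + ∑' t : ℕ, H (t + 2) := by
    unfold V
    rw [(V_summable 0).tsum_eq_zero_add]
    congr 1
    · have : (0 : ℤ) + ((0 + 1 : ℕ) : ℤ) = ((1 : ℕ) : ℤ) := by norm_num
      rw [this, L_nat]; ring
    · apply tsum_congr; intro t
      have : (0 : ℤ) + ((t + 1 + 1 : ℕ) : ℤ) = ((t + 2 : ℕ) : ℤ) := by push_cast; ring
      rw [this, L_nat]; ring
  have e3 : L 0 = pp 0 + H 0 := L_nat 0
  have e4 : pp 0 = 3 * Φ 1 := by simp [pp, T]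
  rw [h1, h2, e3, e4]
  linear_combination V_zero

lemma two_pp (k : ℤ) : 2 * pp k = 6 * Φ 1 + (k : ℤ⟦X⟧) * ((k : ℤ⟦X⟧) - 1) := by
  have := congrArg (Int.cast : ℤ → ℤ⟦X⟧) (two_T k)
  push_cast at this
  unfold pp
  linear_combination this

lemma UV_formula (j : ℤ) : 6 * (L j + U j + V j) =
    18 * Φ 1 * (j : ℤ⟦X⟧) + ((j : ℤ⟦X⟧) + 1) * (j : ℤ⟦X⟧) * ((j : ℤ⟦X⟧) - 1) := by
  have step : ∀ j : ℤ, L (j + 1) + U (j + 1) + V (j + 1) = L j + U j + V j + pp (j + 1) := by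
    intro j
    rw [U_succ, V_succ j]; ring
  induction j using Int.induction_on with
  | zero => rw [UV_zero]; simp
  | succ i ih =>
    have h1 := step i
    have h2 := two_pp (i + 1)
    push_cast at h2 ih ⊢
    linear_combination 6 * h1 + ih + 3 * h2
  | pred i ih =>
    have h1 := step (-(i : ℤ) - 1)
    have h2 := two_pp (-(i : ℤ) - 1 + 1)
    have h3 : -(i : ℤ) - 1 + 1 = -i := by ring
    rw [h3] at h1 h2
    push_cast at h2 ih ⊢
    linear_combination -6 * h1 + ih - 3 * h2

/-- convolution with `K` -/
noncomputable def A (k : ℤ) : ℤ⟦X⟧ :=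
  ∑' t : ℕ, (K (t + 1) * L (k - ((t + 1 : ℕ) : ℤ)) - E (t + 1) * L (k + ((t + 1 : ℕ) : ℤ)))

lemma A_summable (k : ℤ) : Summable fun t : ℕ =>
    (K (t + 1) * L (k - ((t + 1 : ℕ) : ℤ)) - E (t + 1) * L (k + ((t + 1 : ℕ) : ℤ))) := by
  apply summNc k.natAbs
  intro t
  apply dvd_sub
  · exact (L_sub_dvd k t).mul_left _
  · exact ((pow_dvd_pow _ (by omega)).trans (E_dvd (t + 1))).mul_right _

lemma A_rec (k : ℤ) (a b : ℕ) (h : (b : ℤ) = a + (k - 2)) :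
    X ^ a * A (k - 3) + X ^ b * A k =
      X ^ a * (U (k - 3) + V (k - 3) - (2 * ((k - 3 : ℤ) : ℤ⟦X⟧) - 1) * Φ 1) := by
  have h1 := ((A_summable (k - 3)).hasSum.mul_left (X ^ a)).add
    ((A_summable k).hasSum.mul_left (X ^ b))
  have h2 := (((U_summable (k - 3)).hasSum.add (V_summable (k - 3)).hasSum).sub
    ((Φ_summable 1).hasSum.mul_left (2 * ((k - 3 : ℤ) : ℤ⟦X⟧) - 1))).mul_left (X ^ a)
  refine h1.unique ?_
  refine Eq.mp ?_ h2
  congr 1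
  funext t
  have r1 := L_rec (k - ((t + 1 : ℕ) : ℤ)) (a + (t + 1)) b (by push_cast; omega)
  have r2 := L_rec (k + ((t + 1 : ℕ) : ℤ)) a (b + (t + 1)) (by push_cast; omega)
  have e1 : k - ((t + 1 : ℕ) : ℤ) - 3 = k - 3 - ((t + 1 : ℕ) : ℤ) := by ring
  have e2 : k + ((t + 1 : ℕ) : ℤ) - 3 = k - 3 + ((t + 1 : ℕ) : ℤ) := by ring
  rw [e1] at r1
  rw [e2] at r2
  have p1 := two_T (k - 3 - ((t + 1 : ℕ) : ℤ))
  have p2 := two_T (k - 3 + ((t + 1 : ℕ) : ℤ))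
  have p3 : T (k - 3 - ((t + 1 : ℕ) : ℤ)) - T (k - 3 + ((t + 1 : ℕ) : ℤ)) =
      -(2 * (k - 3) - 1) * ((t + 1 : ℕ) : ℤ) := by
    have : 2 * (T (k - 3 - ((t + 1 : ℕ) : ℤ)) - T (k - 3 + ((t + 1 : ℕ) : ℤ))) =
      2 * (-(2 * (k - 3) - 1) * ((t + 1 : ℕ) : ℤ)) := by rw [mul_sub, p1, p2]; ring
    linarith
  have p4 := congrArg (Int.cast : ℤ → ℤ⟦X⟧) p3
  have p5 : pp (k - 3 - ((t + 1 : ℕ) : ℤ)) - pp (k - 3 + ((t + 1 : ℕ) : ℤ)) =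
      -(2 * ((k - 3 : ℤ) : ℤ⟦X⟧) - 1) * ((t + 1 : ℕ) : ℤ⟦X⟧) := by
    unfold pp
    push_cast at p4 ⊢
    linear_combination p4
  have hK := K_mul (Nat.succ_ne_zero t)
  rw [Nat.succ_eq_add_one] at hK
  unfold E
  rw [pow_add] at r1 r2
  generalize L (k - 3 - ((t + 1 : ℕ) : ℤ)) = l1 at *
  generalize L (k - 3 + ((t + 1 : ℕ) : ℤ)) = l2 at *
  generalize L (k - ((t + 1 : ℕ) : ℤ)) = l3 at *
  generalize L (k + ((t + 1 : ℕ) : ℤ)) = l4 at *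
  generalize pp (k - 3 - ((t + 1 : ℕ) : ℤ)) = p at *
  generalize pp (k - 3 + ((t + 1 : ℕ) : ℤ)) = p' at *
  linear_combination -K (t + 1) * r1 + K (t + 1) * r2 - X ^ a * (l1 + l2 - p') * hK - X ^ a * X ^ (t+1) * K (t+1) * p5

/-- defect -/
noncomputable def W (k : ℤ) : ℤ⟦X⟧ := ((k : ℤ⟦X⟧) - 2) * L k - 3 * A k

lemma coeff_intmul (c : ℤ) (f : ℤ⟦X⟧) (n : ℕ) :
    coeff n ((c : ℤ⟦X⟧) * f) = c * coeff n f := by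
  have : (c : ℤ⟦X⟧) = C c := by simp
  rw [this, coeff_C_mul]

lemma int_cancel (c : ℤ) (hc : c ≠ 0) {a b : ℤ⟦X⟧} (h : (c : ℤ⟦X⟧) * a = c * b) : a = b := by
  ext n
  have := congrArg (coeff n) h
  rw [coeff_intmul, coeff_intmul] at this
  exact mul_left_cancel₀ hc this

lemma two_cancel {a b : ℤ⟦X⟧} (h : 2 * a = 2 * b) : a = b :=
  int_cancel 2 (by norm_num) (by push_cast; exact h)

lemma W_rec (k : ℤ) (a b : ℕ) (h : (b : ℤ) = a + (k - 2)) :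
    X ^ a * W (k - 3) + X ^ b * W k = 0 := by
  have h1 := L_rec k a b h
  have h2 := A_rec k a b h
  have h3 := UV_formula (k - 3)
  have h4 := two_pp (k - 3)
  unfold W
  push_cast at *
  apply two_cancel
  linear_combination 2 * ((k : ℤ⟦X⟧) - 2) * h1 - 6 * h2 - X ^ a * h3 + ((k : ℤ⟦X⟧) - 2) * X ^ a * h4

lemma eq_zero_of_dvd {f : ℤ⟦X⟧} (h : ∀ n, X ^ n ∣ f) : f = 0 := by
  ext d
  rw [X_pow_dvd_iff.1 (h (d + 1)) d (by omega)]; simp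

lemma W_zero (k : ℤ) : W k = 0 := by
  apply eq_zero_of_dvd
  intro n
  induction n generalizing k with
  | zero => simp
  | succ n ih =>
    by_cases hk : 0 ≤ k
    · have h := W_rec (k + 3) 0 (k + 1).toNat (by push_cast; omega)
      have e1 : k + 3 - 3 = k := by ring
      rw [e1, pow_zero, one_mul] at h
      rw [eq_neg_of_add_eq_zero_left h, dvd_neg, pow_succ']
      exact mul_dvd_mul (dvd_pow_self _ (by omega)) (ih _)
    · have h := W_rec k (2 - k).toNat 0 (by push_cast; omega)
      rw [pow_zero, one_mul] at h
      rw [eq_neg_of_add_eq_zero_right h, dvd_neg, pow_succ']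
      exact mul_dvd_mul (dvd_pow_self _ (by omega)) (ih _)

end SptSeven


namespace SptSeven

open PowerSeries Filter Topology
open scoped PowerSeries.WithPiTopology

/-- third difference of `L` -/
noncomputable def y (k : ℤ) : ℤ⟦X⟧ := L k - 3 * L (k - 1) + 3 * L (k - 2) - L (k - 3)

lemma pp_diff (k : ℤ) : pp k - 3 * pp (k - 1) + 3 * pp (k - 2) - pp (k - 3) = 0 := by
  apply two_cancel
  have h0 := two_pp k
  have h1 := two_pp (k - 1)
  have h2 := two_pp (k - 2)
  have h3 := two_pp (k - 3)
  push_cast at *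
  linear_combination h0 - 3 * h1 + 3 * h2 - h3

lemma y_dvd (k : ℤ) : X ^ (k.natAbs - 3) ∣ y k := by
  by_cases h : k.natAbs ≤ 3
  · rw [Nat.sub_eq_zero_of_le h]; simp
  by_cases hk : 0 ≤ k
  · have : y k = (L k - pp k) - 3 * (L (k - 1) - pp (k - 1)) + 3 * (L (k - 2) - pp (k - 2))
        - (L (k - 3) - pp (k - 3)) := by
      unfold y; linear_combination pp_diff k
    rw [this]
    have a0 := L_pos_dvd k (k.natAbs - 3) (by omega)
    have a1 := L_pos_dvd (k - 1) (k.natAbs - 3) (by omega)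
    have a2 := L_pos_dvd (k - 2) (k.natAbs - 3) (by omega)
    have a3 := L_pos_dvd (k - 3) (k.natAbs - 3) (by omega)
    exact ((a0.sub (a1.mul_left 3)).add (a2.mul_left 3)).sub a3
  · unfold y
    have a0 := L_neg_dvd k (k.natAbs - 3) (by omega) (by omega)
    have a1 := L_neg_dvd (k - 1) (k.natAbs - 3) (by omega) (by omega)
    have a2 := L_neg_dvd (k - 2) (k.natAbs - 3) (by omega) (by omega)
    have a3 := L_neg_dvd (k - 3) (k.natAbs - 3) (by omega) (by omega)
    exact ((a0.sub (a1.mul_left 3)).add (a2.mul_left 3)).sub a3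

/-- convolution with `E` -/
noncomputable def B (k : ℤ) : ℤ⟦X⟧ :=
  ∑' t : ℕ, E (t + 1) * (L (k - ((t + 1 : ℕ) : ℤ)) - L (k + ((t + 1 : ℕ) : ℤ)))

lemma B_summable (k : ℤ) : Summable fun t : ℕ =>
    E (t + 1) * (L (k - ((t + 1 : ℕ) : ℤ)) - L (k + ((t + 1 : ℕ) : ℤ))) :=
  summN _ fun t => ((pow_dvd_pow _ (by omega)).trans (E_dvd (t + 1))).mul_right _

lemma A_eq (k : ℤ) : A k = U k + B k := by
  unfold A U B
  rw [← (U_summable k).tsum_add (B_summable k)]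
  apply tsum_congr
  intro t
  rw [K_eq (Nat.succ_ne_zero t)]
  rw [Nat.succ_eq_add_one]
  ring

lemma y_conv (k : ℤ) : HasSum (fun t : ℕ =>
    3 * (E (t + 1) * (y (k - ((t + 1 : ℕ) : ℤ)) - y (k + ((t + 1 : ℕ) : ℤ)))))
      (((k : ℤ⟦X⟧) - 2) * y k) := by
  have b0 := (B_summable k).hasSum
  have b1 := (B_summable (k - 1)).hasSum
  have b2 := (B_summable (k - 2)).hasSum
  have b3 := (B_summable (k - 3)).hasSum
  have b := (((b0.sub (b1.mul_left 3)).add (b2.mul_left 3)).sub b3).mul_left 3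
  refine Eq.mp ?_ b
  congr 1
  · funext t
    unfold y
    have e1 (c : ℤ) : k - c - ((t + 1 : ℕ) : ℤ) = k - ((t + 1 : ℕ) : ℤ) - c := by ring
    have e2 (c : ℤ) : k - c + ((t + 1 : ℕ) : ℤ) = k + ((t + 1 : ℕ) : ℤ) - c := by ring
    simp only [e1, e2]
    ring
  · change 3 * (B k - 3 * B (k - 1) + 3 * B (k - 2) - B (k - 3)) = _
    have w (k : ℤ) : ((k : ℤ⟦X⟧) - 2) * L k = 3 * (U k + B k) := by
      have := W_zero k
      unfold W at this
      rw [A_eq] at this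
      linear_combination this
    have w0 := w k
    have w1 := w (k - 1)
    have w2 := w (k - 2)
    have w3 := w (k - 3)
    have u1 := U_succ (k - 1)
    have u2 := U_succ (k - 2)
    have u3 := U_succ (k - 3)
    have e1 : k - 1 + 1 = k := by ring
    have e2 : k - 2 + 1 = k - 1 := by ring
    have e3 : k - 3 + 1 = k - 2 := by ring
    rw [e1] at u1
    rw [e2] at u2
    rw [e3] at u3
    unfold y
    push_cast at *
    linear_combination -w0 + 3 * w1 - 3 * w2 + w3 - 3 * u1 + 6 * u2 - 3 * u3

lemma mom_summable (p : ℤ → ℤ⟦X⟧) : Summable fun k : ℤ => p k * y k :=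
  summZ 3 _ fun k => (y_dvd k).mul_left _

/-- moments -/
noncomputable def G (j : ℕ) : ℤ⟦X⟧ := ∑' k : ℤ, ((k : ℤ⟦X⟧) - 2) ^ j * y k

lemma G_shift (j : ℕ) (c : ℤ⟦X⟧) : HasSum (fun k : ℤ => ((k : ℤ⟦X⟧) - 2 + c) ^ j * y k)
    (∑ m ∈ Finset.range (j + 1), c ^ (j - m) * (j.choose m : ℤ⟦X⟧) * G m) := by
  have h := hasSum_sum (s := Finset.range (j + 1)) (fun m _ =>
    (mom_summable (fun k => ((k : ℤ⟦X⟧) - 2) ^ m)).hasSum.mul_left (c ^ (j - m) * (j.choose m : ℤ⟦X⟧)))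
  refine Eq.mp ?_ h
  congr 1
  funext k
  rw [add_pow, Finset.sum_mul]
  apply Finset.sum_congr rfl
  intro m _
  ring

lemma G_rec (j : ℕ) : G (j + 1) =
    3 * ∑ m ∈ Finset.range (j + 1), (1 - (-1) ^ (j - m)) * (j.choose m : ℤ⟦X⟧) * Φ (j - m) * G m := by
  let F : ℤ → ℕ → ℤ⟦X⟧ := fun k t => ((k : ℤ⟦X⟧) - 2) ^ j *
    (3 * (E (t + 1) * (y (k - ((t + 1 : ℕ) : ℤ)) - y (k + ((t + 1 : ℕ) : ℤ)))))
  have hs : Summable (Function.uncurry F) := by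
    refine summ _ (fun p : ℤ × ℕ => p.2 + (p.1.natAbs - (p.2 + 1) - 3)) ?_ ?_
    · intro N
      refine ((Set.finite_Icc (-(2 * N + 4 : ℤ)) (2 * N + 4)).prod (Set.finite_Iic N)).subset ?_
      rintro ⟨k, t⟩ h
      simp only [Set.mem_ofPred_eq] at h
      simp only [Set.mem_prod, Set.mem_Icc, Set.mem_Iic]
      omega
    · rintro ⟨k, t⟩
      simp only [Function.uncurry, F]
      refine Dvd.dvd.mul_left (Dvd.dvd.mul_left ?_ _) _
      rw [pow_add]
      apply mul_dvd_mul
      · exact (pow_dvd_pow _ (by omega)).trans (E_dvd (t + 1))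
      · apply dvd_sub
        · exact (pow_dvd_pow _ (by omega)).trans (y_dvd _)
        · exact (pow_dvd_pow _ (by omega)).trans (y_dvd _)
  have h1 : G (j + 1) = ∑' k : ℤ, ∑' t : ℕ, F k t := by
    unfold G
    apply tsum_congr
    intro k
    rw [((y_conv k).mul_left (((k : ℤ⟦X⟧) - 2) ^ j)).tsum_eq]
    ring
  have h2 (t : ℕ) : HasSum (fun k : ℤ => F k t) (3 * E (t + 1) *
      ∑ m ∈ Finset.range (j + 1), (1 - (-1) ^ (j - m)) * ((t + 1 : ℕ) : ℤ⟦X⟧) ^ (j - m) *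
        (j.choose m : ℤ⟦X⟧) * G m) := by
    have a1 := G_shift j ((t + 1 : ℕ) : ℤ⟦X⟧)
    have a2 := G_shift j (-((t + 1 : ℕ) : ℤ⟦X⟧))
    rw [← (Equiv.subRight (((t + 1 : ℕ) : ℤ))).hasSum_iff] at a1
    rw [← (Equiv.addRight (((t + 1 : ℕ) : ℤ))).hasSum_iff] at a2
    have a3 := (a1.sub a2).mul_left (3 * E (t + 1))
    refine Eq.mp ?_ a3
    congr 1
    · funext k
      simp only [F, Function.comp, Equiv.subRight_apply, Equiv.coe_addRight]
      push_cast
      ring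
    · rw [← Finset.sum_sub_distrib]
      congr 1
      apply Finset.sum_congr rfl
      intro m _
      rw [neg_pow ((t + 1 : ℕ) : ℤ⟦X⟧)]
      ring
  rw [h1, ← Summable.tsum_comm hs]
  simp_rw [fun t => (h2 t).tsum_eq]
  rw [Finset.mul_sum]
  have h3 := hasSum_sum (s := Finset.range (j + 1)) (fun m _ =>
    (Φ_summable (j - m)).hasSum.mul_left (3 * ((1 - (-1) ^ (j - m)) * (j.choose m : ℤ⟦X⟧) * G m)))
  have h4 : (∑ m ∈ Finset.range (j + 1), 3 * ((1 - (-1) ^ (j - m)) * (j.choose m : ℤ⟦X⟧) * G m) * Φ (j - m)) =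
     ∑ m ∈ Finset.range (j + 1), 3 * ((1 - (-1) ^ (j - m)) * (j.choose m : ℤ⟦X⟧) * Φ (j - m) * G m) := by
    apply Finset.sum_congr rfl
    intro m _
    ring
  rw [← h4]
  refine Eq.trans ?_ h3.tsum_eq
  apply tsum_congr
  intro t
  rw [Finset.mul_sum]
  apply Finset.sum_congr rfl
  intro m _
  ring

/-- decaying part of `L` -/
noncomputable def ll (k : ℤ) : ℤ⟦X⟧ := L k - if 0 ≤ k then pp k else 0

lemma ll_dvd (k : ℤ) : X ^ (k.natAbs) ∣ ll k := by
  unfold ll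
  split_ifs with h
  · exact L_pos_dvd k _ (by omega)
  · rw [sub_zero]; exact L_neg_dvd k _ (by omega) (by omega)

lemma ll_summable (p : ℤ → ℤ⟦X⟧) : Summable fun k : ℤ => p k * ll k :=
  summZ 0 _ fun k => by simpa using (ll_dvd k).mul_left (p k)

lemma pairing (p : ℤ → ℤ⟦X⟧) : ∑' k : ℤ, p k * y k =
    (∑' k : ℤ, (p k - 3 * p (k + 1) + 3 * p (k + 2) - p (k + 3)) * ll k) +
      (3 * Φ 1 * p 0 - 6 * Φ 1 * p 1 + (3 * Φ 1 + 1) * p 2) := by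
  have a0 := (ll_summable p).hasSum
  have sh (c : ℤ) : HasSum (fun k : ℤ => p k * ll (k - c)) (∑' k : ℤ, p (k + c) * ll k) := by
    have := (ll_summable (fun k => p (k + c))).hasSum
    rw [← (Equiv.subRight c).hasSum_iff] at this
    refine Eq.mp ?_ this
    congr 1
    funext k
    simp [Function.comp]
  let χ : ℤ → ℤ⟦X⟧ := fun k => if 0 ≤ k then pp k else 0
  have hχ : HasSum (fun k : ℤ => p k * (χ k - 3 * χ (k - 1) + 3 * χ (k - 2) - χ (k - 3)))
      (∑ k ∈ ({0, 1, 2} : Finset ℤ), p k * (χ k - 3 * χ (k - 1) + 3 * χ (k - 2) - χ (k - 3))) := by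
    apply hasSum_sum_of_ne_finset_zero
    intro k hk
    simp only [Finset.mem_insert, Finset.mem_singleton, not_or] at hk
    by_cases h : 0 ≤ k
    · have e0 : χ k = pp k := if_pos (by omega)
      have e1 : χ (k - 1) = pp (k - 1) := if_pos (by omega)
      have e2 : χ (k - 2) = pp (k - 2) := if_pos (by omega)
      have e3 : χ (k - 3) = pp (k - 3) := if_pos (by omega)
      rw [e0, e1, e2, e3, pp_diff, mul_zero]
    · have e0 : χ k = 0 := if_neg (by omega)
      have e1 : χ (k - 1) = 0 := if_neg (by omega)
      have e2 : χ (k - 2) = 0 := if_neg (by omega)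
      have e3 : χ (k - 3) = 0 := if_neg (by omega)
      rw [e0, e1, e2, e3]; ring
  have hsum : (∑ k ∈ ({0, 1, 2} : Finset ℤ), p k * (χ k - 3 * χ (k - 1) + 3 * χ (k - 2) - χ (k - 3))) =
      3 * Φ 1 * p 0 - 6 * Φ 1 * p 1 + (3 * Φ 1 + 1) * p 2 := by
    rw [Finset.sum_insert (by simp), Finset.sum_insert (by simp), Finset.sum_singleton]
    simp [χ, pp, T]
    ring
  have tot := (((a0.sub ((sh 1).mul_left 3)).add ((sh 2).mul_left 3)).sub (sh 3)).add hχ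
  rw [hsum] at tot
  have tot2 : HasSum (fun k : ℤ => (p k - 3 * p (k + 1) + 3 * p (k + 2) - p (k + 3)) * ll k)
     ((∑' k : ℤ, p k * ll k) - 3 * (∑' k : ℤ, p (k + 1) * ll k) + 3 * (∑' k : ℤ, p (k + 2) * ll k)
       - ∑' k : ℤ, p (k + 3) * ll k) := by
    have := (((a0.sub ((ll_summable (fun k => p (k + 1))).hasSum.mul_left 3)).add
      ((ll_summable (fun k => p (k + 2))).hasSum.mul_left 3)).sub
      ((ll_summable (fun k => p (k + 3))).hasSum))
    refine Eq.mp ?_ this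
    congr 1
    funext k
    ring
  rw [tot2.tsum_eq, ← tot.tsum_eq]
  apply tsum_congr
  intro k
  simp only [ll, y, χ]
  ring

lemma G_zero : G 0 = 1 := by
  have := pairing (fun _ => 1)
  unfold G
  simp only [pow_zero]
  rw [this]
  have h : (fun k : ℤ => ((1 : ℤ⟦X⟧) - 3 * 1 + 3 * 1 - 1) * ll k) = fun _ => 0 := by
    funext k; ring
  rw [h, tsum_zero]
  ring

/-- the fifth moment -/
noncomputable def M5 : ℤ⟦X⟧ := ∑' k : ℤ, (2 * (k : ℤ⟦X⟧) - 1) ^ 5 * ll k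

lemma M5_eq : 84 * M5 = -119 * G 4 + 56 * G 6 - 8 * G 8 + 678 * Φ 1 := by
  have h := pairing (fun k => -119 * ((k : ℤ⟦X⟧) - 2) ^ 4 + 56 * ((k : ℤ⟦X⟧) - 2) ^ 6
    - 8 * ((k : ℤ⟦X⟧) - 2) ^ 8)
  have a := (((mom_summable (fun k => ((k : ℤ⟦X⟧) - 2) ^ 4)).hasSum.mul_left (-119)).add
    ((mom_summable (fun k => ((k : ℤ⟦X⟧) - 2) ^ 6)).hasSum.mul_left 56)).sub
    ((mom_summable (fun k => ((k : ℤ⟦X⟧) - 2) ^ 8)).hasSum.mul_left 8)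
  have b := (ll_summable (fun k => (2 * (k : ℤ⟦X⟧) - 1) ^ 5)).hasSum.mul_left 84
  have c1 : (∑' k : ℤ, (-119 * ((k : ℤ⟦X⟧) - 2) ^ 4 + 56 * ((k : ℤ⟦X⟧) - 2) ^ 6
    - 8 * ((k : ℤ⟦X⟧) - 2) ^ 8) * y k) = -119 * G 4 + 56 * G 6 - 8 * G 8 := by
    refine Eq.trans ?_ a.tsum_eq
    apply tsum_congr
    intro k; ring
  rw [c1] at h
  rw [h]
  have c2 : 84 * M5 = _ := b.tsum_eq.symm
  rw [c2]
  have c3 : (∑' k : ℤ, 84 * ((2 * (k : ℤ⟦X⟧) - 1) ^ 5 * ll k)) = ∑' k : ℤ, ((-119 * ((k : ℤ⟦X⟧) - 2) ^ 4 + 56 * ((k : ℤ⟦X⟧) - 2) ^ 6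
    - 8 * ((k : ℤ⟦X⟧) - 2) ^ 8) - 3 * (-119 * (((k + 1 : ℤ) : ℤ⟦X⟧) - 2) ^ 4 + 56 * (((k + 1 : ℤ) : ℤ⟦X⟧) - 2) ^ 6
    - 8 * (((k + 1 : ℤ) : ℤ⟦X⟧) - 2) ^ 8) + 3 * (-119 * (((k + 2 : ℤ) : ℤ⟦X⟧) - 2) ^ 4 + 56 * (((k + 2 : ℤ) : ℤ⟦X⟧) - 2) ^ 6
    - 8 * (((k + 2 : ℤ) : ℤ⟦X⟧) - 2) ^ 8) - (-119 * (((k + 3 : ℤ) : ℤ⟦X⟧) - 2) ^ 4 + 56 * (((k + 3 : ℤ) : ℤ⟦X⟧) - 2) ^ 6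
    - 8 * (((k + 3 : ℤ) : ℤ⟦X⟧) - 2) ^ 8)) * ll k := by
    apply tsum_congr
    intro k
    push_cast
    ring
  rw [c3]
  push_cast
  ring

lemma G_one : G 1 = 0 := by
  rw [G_rec 0]; simp

lemma G_two : G 2 = 6 * Φ 1 := by
  rw [G_rec 1]; simp [Finset.sum_range_succ, G_zero, G_one]; ring

lemma G_three : G 3 = 0 := by
  rw [G_rec 2]; simp [Finset.sum_range_succ, G_one]

lemma G_four : G 4 = 6 * (3 * Φ 1 * G 2 + Φ 3) := by
  rw [G_rec 3]; simp [Finset.sum_range_succ, G_zero, G_one, G_three]; norm_num [Nat.choose]; ring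

lemma G_five : G 5 = 0 := by
  have h4 : (1 - (-1) ^ 4 : ℤ⟦X⟧) = 0 := by ring
  rw [G_rec 4]; simp [Finset.sum_range_succ, G_one, G_three, h4]

lemma G_six : G 6 = 6 * (5 * Φ 1 * G 4 + 10 * Φ 3 * G 2 + Φ 5) := by
  rw [G_rec 5]; simp [Finset.sum_range_succ, G_zero, G_one, G_three, G_five]; norm_num [Nat.choose]; ring

lemma G_seven : G 7 = 0 := by
  have h4 : (1 - (-1) ^ 4 : ℤ⟦X⟧) = 0 := by ring
  have h6 : (1 - (-1) ^ 6 : ℤ⟦X⟧) = 0 := by ring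
  rw [G_rec 6]; simp [Finset.sum_range_succ, G_one, G_three, G_five, h4, h6]

lemma G_eight : G 8 = 6 * (7 * Φ 1 * G 6 + 35 * Φ 3 * G 4 + 21 * Φ 5 * G 2 + Φ 7) := by
  rw [G_rec 7]; simp [Finset.sum_range_succ, G_zero, G_one, G_three, G_five, G_seven]; norm_num [Nat.choose]; ring

end SptSeven


namespace SptSeven

open PowerSeries Filter Topology
open scoped PowerSeries.WithPiTopology

/-! ### Convolution identities -/

/-- trichotomy decomposition -/
lemma tri {ι : Type*} (g : ι × (ℕ × ℕ) → ℤ⟦X⟧) (w : ι × (ℕ × ℕ) → ℕ)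
    (hw : ∀ N, {i | w i ≤ N}.Finite) (h : ∀ i, X ^ (w i) ∣ g i) :
    ∑' i, g i = (∑' i : ι × (ℕ × ℕ), g (i.1, (i.2.1, i.2.1 + i.2.2 + 1))) +
      (∑' i : ι × ℕ, g (i.1, (i.2, i.2))) +
      ∑' i : ι × (ℕ × ℕ), g (i.1, (i.2.1 + i.2.2 + 1, i.2.1)) := by
  classical
  let g1 : ι × (ℕ × ℕ) → ℤ⟦X⟧ := fun i => if i.2.1 < i.2.2 then g i else 0
  let g2 : ι × (ℕ × ℕ) → ℤ⟦X⟧ := fun i => if i.2.1 = i.2.2 then g i else 0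
  let g3 : ι × (ℕ × ℕ) → ℤ⟦X⟧ := fun i => if i.2.2 < i.2.1 then g i else 0
  have s1 : Summable g1 := summ g1 w hw fun i => by
    simp only [g1]; split_ifs <;> simp [h]
  have s2 : Summable g2 := summ g2 w hw fun i => by
    simp only [g2]; split_ifs <;> simp [h]
  have s3 : Summable g3 := summ g3 w hw fun i => by
    simp only [g3]; split_ifs <;> simp [h]
  have hsum : ∑' i, g i = ∑' i, g1 i + ∑' i, g2 i + ∑' i, g3 i := by
    rw [← s1.tsum_add s2, ← (s1.add s2).tsum_add s3]
    apply tsum_congr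
    intro i
    simp only [g1, g2, g3]
    rcases lt_trichotomy i.2.1 i.2.2 with hh | hh | hh
    · simp [hh, hh.ne, hh.le]
    · simp [hh]
    · simp [hh, hh.ne', hh.le]
  rw [hsum]
  congr 1
  · congr 1
    · have hi : Function.Injective (fun i : ι × (ℕ × ℕ) => (i.1, (i.2.1, i.2.1 + i.2.2 + 1))) := by
        rintro ⟨i, x, y⟩ ⟨i', x', y'⟩ hh
        simp only [Prod.mk.injEq] at hh ⊢
        obtain ⟨h1, h2, h3⟩ := hh
        refine ⟨h1, h2, ?_⟩
        omega
      rw [← hi.tsum_eq]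
      · apply tsum_congr
        rintro ⟨i, x, y⟩
        simp only [g1]
        rw [if_pos (by omega)]
      · rintro ⟨i, x, y⟩ hh
        simp only [g1, Function.mem_support, ne_eq, ite_eq_right_iff, Classical.not_imp] at hh
        exact ⟨(i, (x, y - x - 1)), by simp; omega⟩
    · have hi : Function.Injective (fun i : ι × ℕ => (i.1, (i.2, i.2))) := by
        rintro ⟨i, x⟩ ⟨i', x'⟩ hh
        simp only [Prod.mk.injEq] at hh ⊢
        exact ⟨hh.1, hh.2.1⟩
      rw [← hi.tsum_eq]
      · apply tsum_congr
        rintro ⟨i, x⟩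
        simp only [g2]
        simp
      · rintro ⟨i, x, y⟩ hh
        simp only [g2, Function.mem_support, ne_eq, ite_eq_right_iff, Classical.not_imp] at hh
        exact ⟨(i, x), by simp; omega⟩
  · have hi : Function.Injective (fun i : ι × (ℕ × ℕ) => (i.1, (i.2.1 + i.2.2 + 1, i.2.1))) := by
      rintro ⟨i, x, y⟩ ⟨i', x', y'⟩ hh
      simp only [Prod.mk.injEq] at hh ⊢
      obtain ⟨h1, h2, h3⟩ := hh
      refine ⟨h1, h3, ?_⟩
      omega
    rw [← hi.tsum_eq]
    · apply tsum_congr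
      rintro ⟨i, x, y⟩
      simp only [g3]
      rw [if_pos (by omega)]
    · rintro ⟨i, x, y⟩ hh
      simp only [g3, Function.mem_support, ne_eq, ite_eq_right_iff, Classical.not_imp] at hh
      exact ⟨(i, (y, x - y - 1)), by simp; omega⟩

/-- general quadruple term -/
noncomputable def qt (p : ℤ → ℤ → ℤ) (a b x y : ℕ) : ℤ⟦X⟧ :=
  ((p (a + 1) (b + 1) : ℤ) : ℤ⟦X⟧) * X ^ ((a + 1) * (x + 1) + (b + 1) * (y + 1))

lemma qt_dvd (p : ℤ → ℤ → ℤ) (a b x y : ℕ) : X ^ (a + b + x + y) ∣ qt p a b x y :=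
  Dvd.dvd.mul_left (pow_dvd_pow _ (by nlinarith [Nat.zero_le (a * x), Nat.zero_le (b * y)])) _

lemma fin4 (N : ℕ) : {i : (ℕ × ℕ) × (ℕ × ℕ) | i.1.1 + i.1.2 + i.2.1 + i.2.2 ≤ N}.Finite := by
  refine (((Set.finite_Iic N).prod (Set.finite_Iic N)).prod
    ((Set.finite_Iic N).prod (Set.finite_Iic N))).subset ?_
  rintro ⟨⟨a, b⟩, x, y⟩ h
  simp only [Set.mem_ofPred_eq] at h
  simp only [Set.mem_prod, Set.mem_Iic]
  omega

/-- quadruple sums -/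
noncomputable def S (p : ℤ → ℤ → ℤ) : ℤ⟦X⟧ :=
  ∑' i : (ℕ × ℕ) × (ℕ × ℕ), qt p i.1.1 i.1.2 i.2.1 i.2.2

lemma S_summable (p : ℤ → ℤ → ℤ) :
    Summable fun i : (ℕ × ℕ) × (ℕ × ℕ) => qt p i.1.1 i.1.2 i.2.1 i.2.2 :=
  summ _ _ fin4 fun i => qt_dvd p _ _ _ _

/-- diagonal in `x = y` -/
noncomputable def Sx (p : ℤ → ℤ → ℤ) : ℤ⟦X⟧ :=
  ∑' i : (ℕ × ℕ) × ℕ, qt p i.1.1 i.1.2 i.2 i.2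

/-- diagonal in `a = b` -/
noncomputable def Sa (p : ℤ → ℤ → ℤ) : ℤ⟦X⟧ :=
  ∑' i : (ℕ × ℕ) × ℕ, qt p i.2 i.2 i.1.1 i.1.2

lemma liouville (p : ℤ → ℤ → ℤ) (hp : ∀ a b, p a b = p b a)
    (hf : ∀ a b, p (a - b) b = p (b - a) a) :
    S p - S (fun a b => p (a - b) b) = Sx p - Sa (fun a b => p (a - b) b) := by
  have h1 := tri (fun i : (ℕ × ℕ) × (ℕ × ℕ) => qt p i.1.1 i.1.2 i.2.1 i.2.2) _ fin4
    fun i => qt_dvd p _ _ _ _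
  have h2 := tri (fun i : (ℕ × ℕ) × (ℕ × ℕ) => qt (fun a b => p (a - b) b) i.2.1 i.2.2 i.1.1 i.1.2)
    (fun i => i.1.1 + i.1.2 + i.2.1 + i.2.2) fin4
    fun i => (pow_dvd_pow _ (by omega)).trans (qt_dvd _ _ _ _ _)
  have h3 : S (fun a b => p (a - b) b) = ∑' i : (ℕ × ℕ) × (ℕ × ℕ), qt (fun a b => p (a - b) b) i.2.1 i.2.2 i.1.1 i.1.2 := by
    unfold S
    rw [← (Equiv.prodComm (ℕ × ℕ) (ℕ × ℕ)).tsum_eq]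
    rfl
  -- the common value
  let Z : ℤ⟦X⟧ := ∑' i : (ℕ × ℕ) × (ℕ × ℕ), qt p i.1.1 i.1.2 i.2.1 (i.2.1 + i.2.2 + 1)
  have z2 : (∑' i : (ℕ × ℕ) × (ℕ × ℕ), qt p i.1.1 i.1.2 (i.2.1 + i.2.2 + 1) i.2.1) = Z := by
    let eq : (ℕ × ℕ) × (ℕ × ℕ) ≃ (ℕ × ℕ) × (ℕ × ℕ) :=
      ⟨fun i => ((i.1.2, i.1.1), i.2), fun i => ((i.1.2, i.1.1), i.2), fun _ => rfl, fun _ => rfl⟩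
    rw [← eq.tsum_eq]
    apply tsum_congr
    rintro ⟨⟨a, b⟩, x, y⟩
    simp only [eq, Equiv.coe_fn_mk, qt]
    rw [hp]
    congr 2
    ring
  have z3 : (∑' i : (ℕ × ℕ) × (ℕ × ℕ), qt (fun a b => p (a - b) b) (i.2.1 + i.2.2 + 1) i.2.1 i.1.1 i.1.2) = Z := by
    let eq : (ℕ × ℕ) × (ℕ × ℕ) ≃ (ℕ × ℕ) × (ℕ × ℕ) :=
      ⟨fun i => ((i.2.2, i.2.1), i.1), fun i => (i.2, (i.1.2, i.1.1)), fun _ => rfl, fun _ => rfl⟩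
    simp only [Z]
    rw [← eq.tsum_eq (fun i => qt p i.1.1 i.1.2 i.2.1 (i.2.1 + i.2.2 + 1))]
    apply tsum_congr
    rintro ⟨⟨x, y⟩, b, d⟩
    simp only [eq, Equiv.coe_fn_mk, qt]
    congr 2
    · congr 1; push_cast; ring
    · ring
  have z4 : (∑' i : (ℕ × ℕ) × (ℕ × ℕ), qt (fun a b => p (a - b) b) i.2.1 (i.2.1 + i.2.2 + 1) i.1.1 i.1.2) = Z := by
    rw [← z3]
    let eq : (ℕ × ℕ) × (ℕ × ℕ) ≃ (ℕ × ℕ) × (ℕ × ℕ) :=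
      ⟨fun i => ((i.1.2, i.1.1), i.2), fun i => ((i.1.2, i.1.1), i.2), fun _ => rfl, fun _ => rfl⟩
    rw [← eq.tsum_eq]
    apply tsum_congr
    rintro ⟨⟨a, b⟩, x, y⟩
    simp only [eq, Equiv.coe_fn_mk, qt]
    rw [hf]
    congr 2
    ring
  rw [h3, h2]
  unfold S
  rw [h1]
  simp only at z2 z3 z4 ⊢
  rw [z2, z3, z4]
  simp only [Sx, Sa, Z]
  ring

lemma fin2 (N : ℕ) : {i : ℕ × ℕ | i.1 + i.2 ≤ N}.Finite := by
  refine ((Set.finite_Iic N).prod (Set.finite_Iic N)).subset ?_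
  rintro ⟨a, b⟩ h
  simp only [Set.mem_ofPred_eq] at h
  simp only [Set.mem_prod, Set.mem_Iic]
  omega

lemma fin3 (N : ℕ) : {i : (ℕ × ℕ) × ℕ | i.1.1 + i.1.2 + i.2 ≤ N}.Finite := by
  refine (((Set.finite_Iic N).prod (Set.finite_Iic N)).prod (Set.finite_Iic N)).subset ?_
  rintro ⟨⟨a, b⟩, x⟩ h
  simp only [Set.mem_ofPred_eq] at h
  simp only [Set.mem_prod, Set.mem_Iic]
  omega

/-- double sums -/
lemma dbl_summable (p : ℕ → ℕ → ℤ) :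
    Summable fun i : ℕ × ℕ => ((p i.1 i.2 : ℤ) : ℤ⟦X⟧) * X ^ ((i.1 + 1) * (i.2 + 1)) :=
  summ _ (fun i => i.1 + i.2) fin2 fun i => Dvd.dvd.mul_left (pow_dvd_pow _ (by nlinarith [Nat.zero_le (i.1 * i.2)])) _

lemma Φ_dbl (i : ℕ) : HasSum (fun j : ℕ × ℕ =>
    ((((j.1 : ℤ) + 1) ^ i : ℤ) : ℤ⟦X⟧) * X ^ ((j.1 + 1) * (j.2 + 1))) (Φ i) := by
  have hs := dbl_summable (fun a _ => ((a : ℤ) + 1) ^ i)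
  have h : Φ i = ∑' j : ℕ × ℕ, ((((j.1 : ℤ) + 1) ^ i : ℤ) : ℤ⟦X⟧) * X ^ ((j.1 + 1) * (j.2 + 1)) := by
    rw [hs.tsum_prod]
    · unfold Φ
      apply tsum_congr
      intro t
      have := (E_tsum (Nat.succ_ne_zero t)).mul_left (((t + 1 : ℕ) : ℤ⟦X⟧) ^ i)
      rw [Nat.succ_eq_add_one] at this
      rw [← this.tsum_eq]
      push_cast
      rfl
  rw [h]
  exact hs.hasSum

lemma DΦ_dbl (i : ℕ) : HasSum (fun j : ℕ × ℕ =>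
    (((((j.1 : ℤ) + 1) ^ (i + 1) * ((j.2 : ℤ) + 1)) : ℤ) : ℤ⟦X⟧) * X ^ ((j.1 + 1) * (j.2 + 1)))
      (D (Φ i)) := by
  refine Eq.mp ?_ (hasSum_D (Φ_dbl i))
  congr 1
  funext j
  rw [D_intmul, D_X_pow]
  push_cast
  ring

lemma S_mul (i j : ℕ) : S (fun a b => a ^ i * b ^ j) = Φ i * Φ j := by
  have h1 := Φ_dbl i
  have h2 := Φ_dbl j
  have hs : Summable fun x : (ℕ × ℕ) × (ℕ × ℕ) =>
    (((((x.1.1 : ℤ) + 1) ^ i : ℤ) : ℤ⟦X⟧) * X ^ ((x.1.1 + 1) * (x.1.2 + 1))) *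
    (((((x.2.1 : ℤ) + 1) ^ j : ℤ) : ℤ⟦X⟧) * X ^ ((x.2.1 + 1) * (x.2.2 + 1))) := by
    refine summ _ _ fin4 ?_
    rintro ⟨⟨a, x⟩, b, y⟩
    have := (qt_dvd (fun a b => a ^ i * b ^ j) a b x y)
    refine (pow_dvd_pow _ (by simp only; omega)).trans (this.trans (dvd_of_eq ?_))
    simp only [qt]
    push_cast
    rw [pow_add]; ring
  have h3 := h1.mul h2 hs
  rw [← h3.tsum_eq]
  let eq : (ℕ × ℕ) × (ℕ × ℕ) ≃ (ℕ × ℕ) × (ℕ × ℕ) :=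
      ⟨fun i => ((i.1.1, i.2.1), (i.1.2, i.2.2)), fun i => ((i.1.1, i.2.1), (i.1.2, i.2.2)), fun _ => rfl, fun _ => rfl⟩
  unfold S
  rw [← eq.tsum_eq]
  apply tsum_congr
  rintro ⟨⟨a, x⟩, b, y⟩
  simp only [eq, Equiv.coe_fn_mk, qt]
  push_cast
  rw [pow_add]; ring

end SptSeven


namespace SptSeven

open PowerSeries Filter Topology
open scoped PowerSeries.WithPiTopology

lemma diag (w : ℕ → ℕ → ℕ → ℤ) (v : ℕ → ℕ → ℤ) (h0 : ∀ x, v 0 x = 0)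
    (h : ∀ n x, v (n + 1) x = ∑ ab ∈ Finset.HasAntidiagonal.antidiagonal n, w ab.1 ab.2 x) :
    ∑' i : (ℕ × ℕ) × ℕ, ((w i.1.1 i.1.2 i.2 : ℤ) : ℤ⟦X⟧) * X ^ ((i.1.1 + i.1.2 + 2) * (i.2 + 1)) =
      ∑' j : ℕ × ℕ, ((v j.1 j.2 : ℤ) : ℤ⟦X⟧) * X ^ ((j.1 + 1) * (j.2 + 1)) := by
  have hs : Summable fun i : (ℕ × ℕ) × ℕ =>
      ((w i.1.1 i.1.2 i.2 : ℤ) : ℤ⟦X⟧) * X ^ ((i.1.1 + i.1.2 + 2) * (i.2 + 1)) := by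
    refine summ _ _ fin3 ?_
    rintro ⟨⟨a, b⟩, x⟩
    exact Dvd.dvd.mul_left (pow_dvd_pow _ (by
      simp only; nlinarith [Nat.zero_le (a * x), Nat.zero_le (b * x)])) _
  have hi : Function.Injective (fun j : ℕ × ℕ => (j.1 + 1, j.2)) := by
    rintro ⟨a, b⟩ ⟨c, d⟩ hh
    simpa using hh
  rw [← hi.tsum_eq]
  swap
  · rintro ⟨a, b⟩ hh
    rcases a with _ | a
    · simp [h0] at hh
    · exact ⟨(a, b), rfl⟩
  let eq : (Σ x : ℕ × ℕ, Finset.HasAntidiagonal.antidiagonal x.1) ≃ (ℕ × ℕ) × ℕ :=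
    ⟨fun i => (i.2.1, i.1.2), fun i => ⟨(i.1.1 + i.1.2, i.2), ⟨i.1, by simp⟩⟩,
      by
        rintro ⟨⟨n, x⟩, ⟨⟨a, b⟩, hab⟩⟩
        simp only [Finset.HasAntidiagonal.mem_antidiagonal] at hab
        subst hab
        rfl, by
        rintro ⟨⟨a, b⟩, x⟩
        rfl⟩
  rw [← eq.tsum_eq]
  have hs' := eq.summable_iff.2 hs
  rw [Function.comp_def] at hs'
  rw [hs'.tsum_sigma]
  apply tsum_congr
  rintro ⟨n, x⟩
  rw [tsum_fintype]
  simp only [eq, Equiv.coe_fn_mk, h]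
  rw [Int.cast_sum, Finset.sum_mul]
  rw [← Finset.sum_coe_sort (Finset.HasAntidiagonal.antidiagonal n)]
  apply Finset.sum_congr rfl
  rintro ⟨⟨a, b⟩, hab⟩ _
  simp only [Finset.HasAntidiagonal.mem_antidiagonal] at hab
  subst hab
  rfl

lemma Sx_eval (p : ℤ → ℤ → ℤ) (κ : ℤ) (P : ℤ → ℤ) (h1 : P 1 = 0)
    (h : ∀ n : ℕ, κ * ∑ ab ∈ Finset.HasAntidiagonal.antidiagonal n, p (ab.1 + 1) (ab.2 + 1) = P (n + 2)) :
    (κ : ℤ⟦X⟧) * Sx p = ∑' j : ℕ × ℕ, ((P (j.1 + 1) : ℤ) : ℤ⟦X⟧) * X ^ ((j.1 + 1) * (j.2 + 1)) := by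
  rw [← diag (fun a b _ => κ * p (a + 1) (b + 1)) (fun n _ => P (n + 1)) (by simpa using h1)]
  · unfold Sx
    have hsx : Summable fun i : (ℕ × ℕ) × ℕ => qt p i.1.1 i.1.2 i.2 i.2 :=
      summ _ _ fin3 fun i => (pow_dvd_pow _ (by omega)).trans (qt_dvd p _ _ _ _)
    rw [← hsx.tsum_mul_left]
    apply tsum_congr
    rintro ⟨⟨a, b⟩, x⟩
    simp only [qt]
    push_cast
    rw [mul_assoc]
    congr 3
    ring
  · intro n x
    rw [← Finset.mul_sum, h]
    congr 1

lemma Sa_eval (p : ℤ → ℤ → ℤ) (κ : ℤ) (i : ℕ) (h : ∀ a, p 0 a = κ * a ^ (i + 1)) :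
    Sa (fun a b => p (a - b) b) = (κ : ℤ⟦X⟧) * (D (Φ i) - Φ (i + 1)) := by
  have h1 := (DΦ_dbl i).sub (Φ_dbl (i + 1))
  have h2 := h1.mul_left (κ : ℤ⟦X⟧)
  rw [← h2.tsum_eq]
  have h3 := diag (fun _ _ a => κ * ((a : ℤ) + 1) ^ (i + 1)) (fun n a => n * (κ * ((a : ℤ) + 1) ^ (i + 1)))
    (by simp) (by intro n a; simp)
  rw [← (Equiv.prodComm ℕ ℕ).tsum_eq] at h3
  refine Eq.trans ?_ (h3.trans ?_)
  · unfold Sa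
    rw [← tsum_congr]
    rintro ⟨⟨x, y⟩, a⟩
    simp only [qt]
    rw [sub_self, h]
    congr 2
    ring
  · apply tsum_congr
    rintro ⟨a, b⟩
    simp only [Equiv.prodComm_apply, Prod.swap]
    push_cast
    ring

lemma S_add (f g : ℤ → ℤ → ℤ) : S (fun a b => f a b + g a b) = S f + S g := by
  unfold S
  rw [← (S_summable f).tsum_add (S_summable g)]
  apply tsum_congr
  intro i
  simp only [qt]
  push_cast; ring

lemma S_sub (f g : ℤ → ℤ → ℤ) : S (fun a b => f a b - g a b) = S f - S g := by
  unfold S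
  rw [← (S_summable f).tsum_sub (S_summable g)]
  apply tsum_congr
  intro i
  simp only [qt]
  push_cast; ring

lemma S_smul (c : ℤ) (f : ℤ → ℤ → ℤ) : S (fun a b => c * f a b) = (c : ℤ⟦X⟧) * S f := by
  unfold S
  rw [← (S_summable f).tsum_mul_left]
  apply tsum_congr
  intro i
  simp only [qt]
  push_cast; ring

lemma liouville' (p : ℤ → ℤ → ℤ) (hp : ∀ a b, p a b = p b a)
    (hf : ∀ a b, p (a - b) b = p (b - a) a) :
    S (fun a b => p a b - p (a - b) b) = Sx p - Sa (fun a b => p (a - b) b) := by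
  rw [← liouville p hp hf, S_sub p (fun a b => p (a - b) b)]

lemma Sx_range (p : ℤ → ℤ → ℤ) (κ : ℤ) (P : ℤ → ℤ) (Q : ℤ → ℤ → ℤ) (h0 : ∀ c, Q 0 c = 0)
    (hs : ∀ m c, Q (m + 1) c = Q m c + κ * p (m + 1) (c - (m + 1)))
    (hP : ∀ m, Q (m + 1) (m + 2) = P (m + 2)) (n : ℕ) :
    κ * ∑ ab ∈ Finset.HasAntidiagonal.antidiagonal n, p (ab.1 + 1) (ab.2 + 1) = P (n + 2) := by
  have key : ∀ (m : ℕ) (c : ℤ), κ * ∑ a ∈ Finset.range m, p (a + 1) (c - (a + 1)) = Q m c := by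
    intro m c
    induction m with
    | zero => simp [h0]
    | succ m ih => rw [Finset.sum_range_succ, mul_add, ih]; push_cast; rw [hs]
  rw [← hP, Finset.Nat.sum_antidiagonal_eq_sum_range_succ_mk]
  have := key (n + 1) (n + 2)
  push_cast at this
  rw [← this]
  congr 1
  apply Finset.sum_congr rfl
  intro a ha
  simp only [Finset.mem_range] at ha
  rw [Nat.cast_sub (by omega)]
  congr 1
  ring

end SptSeven


namespace SptSeven

open PowerSeries Filter Topology
open scoped PowerSeries.WithPiTopology

/-! ### power sums (times 420) -/
def B0 (m : ℤ) : ℤ := 420 * m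
def B1 (m : ℤ) : ℤ := 210 * m * (m + 1)
def B2 (m : ℤ) : ℤ := 70 * m * (m + 1) * (2 * m + 1)
def B3 (m : ℤ) : ℤ := 105 * m ^ 2 * (m + 1) ^ 2
def B4 (m : ℤ) : ℤ := 14 * m * (m + 1) * (2 * m + 1) * (3 * m ^ 2 + 3 * m - 1)
def B5 (m : ℤ) : ℤ := 35 * m ^ 2 * (m + 1) ^ 2 * (2 * m ^ 2 + 2 * m - 1)
def B6 (m : ℤ) : ℤ := 10 * m * (m + 1) * (2 * m + 1) * (3 * m ^ 4 + 6 * m ^ 3 - 3 * m + 1)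

lemma Φ_lin (c1 c2 c3 c4 c5 c6 c7 : ℤ) :
    ∑' j : ℕ × ℕ, (((c1 * ((j.1 : ℤ) + 1) + c2 * ((j.1 : ℤ) + 1) ^ 2 + c3 * ((j.1 : ℤ) + 1) ^ 3
      + c4 * ((j.1 : ℤ) + 1) ^ 4 + c5 * ((j.1 : ℤ) + 1) ^ 5 + c6 * ((j.1 : ℤ) + 1) ^ 6
      + c7 * ((j.1 : ℤ) + 1) ^ 7 : ℤ)) : ℤ⟦X⟧) * X ^ ((j.1 + 1) * (j.2 + 1)) =
    (c1 : ℤ⟦X⟧) * Φ 1 + c2 * Φ 2 + c3 * Φ 3 + c4 * Φ 4 + c5 * Φ 5 + c6 * Φ 6 + c7 * Φ 7 := by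
  have h := (((((((Φ_dbl 1).mul_left (c1 : ℤ⟦X⟧)).add ((Φ_dbl 2).mul_left (c2 : ℤ⟦X⟧))).add
    ((Φ_dbl 3).mul_left (c3 : ℤ⟦X⟧))).add ((Φ_dbl 4).mul_left (c4 : ℤ⟦X⟧))).add
    ((Φ_dbl 5).mul_left (c5 : ℤ⟦X⟧))).add ((Φ_dbl 6).mul_left (c6 : ℤ⟦X⟧))).add
    ((Φ_dbl 7).mul_left (c7 : ℤ⟦X⟧))
  rw [← h.tsum_eq]
  apply tsum_congr
  intro j
  push_cast
  ring

lemma S_mul' (c : ℤ) (i j : ℕ) : S (fun a b => c * (a ^ i * b ^ j)) = (c : ℤ⟦X⟧) * (Φ i * Φ j) := by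
  rw [S_smul c (fun a b => a ^ i * b ^ j), S_mul]

lemma Sx_full (p : ℤ → ℤ → ℤ) (κ : ℤ) (P : ℤ → ℤ) (h1 : P 1 = 0) (Q : ℤ → ℤ → ℤ)
    (h0 : ∀ c, Q 0 c = 0)
    (hs : ∀ m c, Q (m + 1) c = Q m c + κ * p (m + 1) (c - (m + 1)))
    (hP : ∀ m, Q (m + 1) (m + 2) = P (m + 2)) :
    (κ : ℤ⟦X⟧) * Sx p = ∑' j : ℕ × ℕ, ((P (j.1 + 1) : ℤ) : ℤ⟦X⟧) * X ^ ((j.1 + 1) * (j.2 + 1)) :=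
  Sx_eval p κ P h1 (Sx_range p κ P Q h0 hs hP)

lemma liouville'' (p : ℤ → ℤ → ℤ) (hp : ∀ a b, p a b = p b a)
    (hf : ∀ a b, p (a - b) b = p (b - a) a) (κ : ℤ) (i : ℕ) (h : ∀ a, p 0 a = κ * a ^ (i + 1)) :
    S (fun a b => p a b - p (a - b) b) = Sx p - (κ : ℤ⟦X⟧) * (D (Φ i) - Φ (i + 1)) := by
  rw [liouville' p hp hf, Sa_eval p κ i h]

lemma rel_one : 12 * Φ 1 ^ 2 = 5 * Φ 3 + Φ 1 - 6 * D (Φ 1) := by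
  have h1 := liouville'' (fun a b => a ^ 2 + a * b + b ^ 2) (fun a b => by ring) (fun a b => by ring) 1 1
    (fun a => by ring)
  have h2 := Sx_full (fun a b => a ^ 2 + a * b + b ^ 2) 420
    (fun c => 70 * c + (-420) * c ^ 2 + 350 * c ^ 3 + 0 * c ^ 4 + 0 * c ^ 5 + 0 * c ^ 6 + 0 * c ^ 7)
    (by norm_num)
    (fun m c => B2 m - B1 m * c + B0 m * c ^ 2)
      (by intro c; simp [B0, B1, B2]) (by intro m c; simp only [B0, B1, B2]; ring)
      (by intro m; simp only [B0, B1, B2]; ring)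
  rw [Φ_lin] at h2
  have h3 : (fun a b : ℤ => (a ^ 2 + a * b + b ^ 2) - ((a - b) ^ 2 + (a - b) * b + b ^ 2))
    = fun a b => 2 * (a ^ 1 * b ^ 1) := by funext a b; ring
  simp only [h3] at h1
  rw [S_mul'] at h1
  apply int_cancel 70 (by norm_num)
  push_cast at h1 h2 ⊢
  linear_combination 420 * h1 + h2

lemma rel_two : 240 * (Φ 1 * Φ 3) = 21 * Φ 5 - 30 * D (Φ 3) + 10 * Φ 3 - Φ 1 := by
  have h1 := liouville'' (fun a b => (a ^ 2 + a * b + b ^ 2) ^ 2) (fun a b => by ring) (fun a b => by ring) 1 3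
    (fun a => by ring)
  have h2 := Sx_full (fun a b => (a ^ 2 + a * b + b ^ 2) ^ 2) 420
    (fun c => (-14) * c + 0 * c ^ 2 + 140 * c ^ 3 + (-420) * c ^ 4 + 294 * c ^ 5 + 0 * c ^ 6 + 0 * c ^ 7)
    (by norm_num)
    (fun m c => B4 m - 2 * B3 m * c + 3 * B2 m * c ^ 2 - 2 * B1 m * c ^ 3 + B0 m * c ^ 4)
      (by intro c; simp [B0, B1, B2, B3, B4]) (by intro m c; simp only [B0, B1, B2, B3, B4]; ring)
      (by intro m; simp only [B0, B1, B2, B3, B4]; ring)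
  rw [Φ_lin] at h2
  have h3 : (fun a b : ℤ => (a ^ 2 + a * b + b ^ 2) ^ 2 - ((a - b) ^ 2 + (a - b) * b + b ^ 2) ^ 2)
    = fun a b => (4 * (a ^ 3 * b ^ 1)) + (4 * (a ^ 1 * b ^ 3)) := by funext a b; ring
  simp only [h3] at h1
  rw [S_add (fun a b => (4 * (a ^ 3 * b ^ 1))) (fun a b => (4 * (a ^ 1 * b ^ 3))), S_mul', S_mul'] at h1
  apply int_cancel 14 (by norm_num)
  push_cast at h1 h2 ⊢
  linear_combination 420 * h1 + h2

lemma rel_four : 120 * Φ 3 ^ 2 = Φ 7 - Φ 3 := by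
  have h1 := liouville'' (fun a b => (a * b * (a + b)) ^ 2) (fun a b => by ring) (fun a b => by ring) 0 3
    (fun a => by ring)
  have h2 := Sx_full (fun a b => (a * b * (a + b)) ^ 2) 420
    (fun c => 0 * c + 0 * c ^ 2 + (-14) * c ^ 3 + 0 * c ^ 4 + 0 * c ^ 5 + 0 * c ^ 6 + 14 * c ^ 7)
    (by norm_num)
    (fun m c => c ^ 2 * (B2 m * c ^ 2 - 2 * B3 m * c + B4 m))
      (by intro c; simp [B2, B3, B4]) (by intro m c; simp only [B2, B3, B4]; ring)
      (by intro m; simp only [B2, B3, B4]; ring)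
  rw [Φ_lin] at h2
  have h3 : (fun a b : ℤ => (a * b * (a + b)) ^ 2 - ((a - b) * b * ((a - b) + b)) ^ 2)
    = fun a b => (4 * (a ^ 3 * b ^ 3)) := by funext a b; ring
  simp only [h3] at h1
  rw [S_mul'] at h1
  apply int_cancel 14 (by norm_num)
  push_cast at h1 h2 ⊢
  linear_combination 420 * h1 + h2

lemma rel_three : 504 * (Φ 1 * Φ 5) = 20 * Φ 7 - 42 * D (Φ 5) + 21 * Φ 5 + Φ 1 := by
  have h1 := liouville'' (fun a b => (a ^ 2 + a * b + b ^ 2) ^ 3) (fun a b => by ring) (fun a b => by ring) 1 5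
    (fun a => by ring)
  have h2 := Sx_full (fun a b => (a ^ 2 + a * b + b ^ 2) ^ 3) 420
    (fun c => 10 * c + 0 * c ^ 2 + (-49) * c ^ 3 + 0 * c ^ 4 + 210 * c ^ 5 + (-420) * c ^ 6 + 249 * c ^ 7)
    (by norm_num)
    (fun m c => B6 m - 3 * B5 m * c + 6 * B4 m * c ^ 2 - 7 * B3 m * c ^ 3
        + 6 * B2 m * c ^ 4 - 3 * B1 m * c ^ 5 + B0 m * c ^ 6)
      (by intro c; simp [B0, B1, B2, B3, B4, B5, B6])
      (by intro m c; simp only [B0, B1, B2, B3, B4, B5, B6]; ring)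
      (by intro m; simp only [B0, B1, B2, B3, B4, B5, B6]; ring)
  rw [Φ_lin] at h2
  have h3 : (fun a b : ℤ => (a ^ 2 + a * b + b ^ 2) ^ 3 - ((a - b) ^ 2 + (a - b) * b + b ^ 2) ^ 3)
    = fun a b => (6 * (a ^ 5 * b ^ 1) + 6 * (a ^ 1 * b ^ 5)) + 14 * (a ^ 3 * b ^ 3) := by
    funext a b; ring
  simp only [h3] at h1
  rw [S_add (fun a b => (6 * (a ^ 5 * b ^ 1) + 6 * (a ^ 1 * b ^ 5))) (fun a b => 14 * (a ^ 3 * b ^ 3)),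
    S_add (fun a b => (6 * (a ^ 5 * b ^ 1))) (fun a b => (6 * (a ^ 1 * b ^ 5))),
    S_mul', S_mul', S_mul'] at h1
  have h4 := rel_four
  apply int_cancel 10 (by norm_num)
  push_cast at h1 h2 ⊢
  linear_combination 420 * h1 + h2 - 49 * h4

end SptSeven


namespace SptSeven

open PowerSeries Filter Topology
open scoped PowerSeries.WithPiTopology

/-! ### reduction modulo 7 -/

lemma e_const : constantCoeff e = 1 := by
  have h1 := PowerSeries.WithPiTopology.hasSum_pow_pentagonal_sub_pentagonalSeries ℤ
  change HasSum _ e at h1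
  have h2 := h1.map (constantCoeff (R := ℤ)) (PowerSeries.WithPiTopology.continuous_constantCoeff ℤ)
  rw [← h2.tsum_eq]
  rw [tsum_eq_single 0]
  · simp [pentagonal_def]
  · intro n hn
    have h3 : pentagonal (-(n : ℤ)) ≠ 0 := by
      rw [pent_neg]; omega
    have h4 : pentagonal ((n : ℤ) + 1) ≠ 0 := by
      have := pent_ge (n + 1)
      push_cast at this
      omega
    simp [h3, h4]

/-- the partition series -/
noncomputable def pS : ℤ⟦X⟧ := invOfUnit e 1

lemma e_mul : e * pS = 1 := by
  apply mul_invOfUnit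
  simp [e_const]

lemma D_pS : D pS = Φ 1 * pS := by
  have h := congrArg D e_mul
  rw [D_mul, D_one, D_e] at h
  have h1 := e_mul
  linear_combination pS * h + (Φ 1 * pS - D pS) * h1

/-- `7` divides the coefficients at `7n+5` of `P f` -/
def Z (f : ℤ⟦X⟧) : Prop := ∀ n : ℕ, (7 : ℤ) ∣ coeff (7 * n + 5) (pS * f)

lemma Z_add {f g : ℤ⟦X⟧} (hf : Z f) (hg : Z g) : Z (f + g) := by
  intro n
  rw [mul_add, map_add]
  exact dvd_add (hf n) (hg n)

lemma Z_int (c : ℤ) {f : ℤ⟦X⟧} (hf : Z f) : Z (c * f) := by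
  intro n
  rw [show pS * (c * f) = c * (pS * f) by ring, coeff_intmul]
  exact (hf n).mul_left _

lemma Z_seven (f : ℤ⟦X⟧) : Z (7 * f) := by
  intro n
  rw [show pS * (7 * f) = ((7 : ℤ) : ℤ⟦X⟧) * (pS * f) by push_cast; ring, coeff_intmul]
  exact Dvd.intro _ rfl

lemma Z_D (f : ℤ⟦X⟧) : Z (Φ 1 * f + D f - 5 * f) := by
  intro n
  have : pS * (Φ 1 * f + D f - 5 * f) = D (pS * f) - ((5 : ℤ) : ℤ⟦X⟧) * (pS * f) := by
    rw [D_mul, D_pS]; push_cast; ring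
  rw [this, map_sub, coeff_intmul, coeff_D]
  refine ⟨n * coeff (7 * n + 5) (pS * f), ?_⟩
  push_cast
  ring

lemma sum_mod {ι : Type*} (f : ι → ℤ⟦X⟧) (w : ι → ℕ) (hw : ∀ N, {i | w i ≤ N}.Finite)
    (h : ∀ i, X ^ (w i) ∣ f i) (a b : ι → ℤ) (hab : ∀ i, (7 : ℤ) ∣ a i - b i) :
    ∃ u, ∑' i, ((a i : ℤ) : ℤ⟦X⟧) * f i = ∑' i, ((b i : ℤ) : ℤ⟦X⟧) * f i + 7 * u := by
  choose c hc using hab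
  have s (d : ι → ℤ) : Summable fun i => ((d i : ℤ) : ℤ⟦X⟧) * f i :=
    summ _ w hw fun i => (h i).mul_left _
  refine ⟨∑' i, ((c i : ℤ) : ℤ⟦X⟧) * f i, ?_⟩
  rw [← (s c).tsum_mul_left, ← (s b).tsum_add ((s c).mul_left 7)]
  apply tsum_congr
  intro i
  have : a i = b i + 7 * c i := by linarith [hc i]
  rw [this]
  push_cast
  ring

lemma fermat (a : ℤ) : (7 : ℤ) ∣ a ^ 7 - a := by
  have : ((a ^ 7 - a : ℤ) : ZMod 7) = 0 := by
    push_cast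
    generalize (a : ZMod 7) = b
    revert b
    decide
  exact_mod_cast (ZMod.intCast_zmod_eq_zero_iff_dvd _ 7).1 this

lemma Φ_seven : ∃ u, Φ 7 = Φ 1 + 7 * u := by
  obtain ⟨u, hu⟩ := sum_mod (fun j : ℕ × ℕ => X ^ ((j.1 + 1) * (j.2 + 1))) (fun i => i.1 + i.2) fin2
    (fun i => pow_dvd_pow _ (by nlinarith [Nat.zero_le (i.1 * i.2)]))
    (fun j => ((j.1 : ℤ) + 1) ^ 7) (fun j => ((j.1 : ℤ) + 1) ^ 1) (fun j => by
      rw [pow_one]; exact fermat _)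
  refine ⟨u, ?_⟩
  rw [← (Φ_dbl 7).tsum_eq, ← (Φ_dbl 1).tsum_eq, ← hu]

lemma mod_one : ∃ u, Φ 1 = Φ 3 ^ 2 + Φ 3 + 7 * u := by
  obtain ⟨u, hu⟩ := Φ_seven
  refine ⟨17 * Φ 3 ^ 2 - u, ?_⟩
  linear_combination -rel_four - hu

lemma mod_two : ∃ w, D (Φ 3) = -Φ 3 ^ 3 + 2 * Φ 3 ^ 2 + Φ 3 + 7 * w := by
  obtain ⟨u, hu⟩ := mod_one
  refine ⟨12 * Φ 5 - 17 * D (Φ 3) - 960 * u * Φ 3 - 4 * u - 137 * Φ 3 ^ 3 - 138 * Φ 3 ^ 2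
    + 5 * Φ 3, ?_⟩
  linear_combination 4 * rel_two + (-4 - 960 * Φ 3) * hu

lemma Z_Φ : Z (Φ 1) := by
  obtain ⟨u, hu⟩ := mod_one
  obtain ⟨w, hw⟩ := mod_two
  have h := Z_add (Z_int 5 (Z_D (Φ 3))) (Z_seven (-5 * w - 5 * u * Φ 3 + 15 * u + 5 * Φ 3 - 2 * Φ 1))
  have : Φ 1 = ((5 : ℤ) : ℤ⟦X⟧) * (Φ 1 * Φ 3 + D (Φ 3) - 5 * Φ 3) +
     7 * (-5 * w - 5 * u * Φ 3 + 15 * u + 5 * Φ 3 - 2 * Φ 1) := by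
    push_cast
    rw [hw, hu]
    ring
  rw [this]
  exact h

lemma Z_one : Z 1 := by
  have h := Z_add (Z_int 4 (Z_D 1)) (Z_add (Z_int (-4) Z_Φ) (Z_seven 3))
  have : (1 : ℤ⟦X⟧) = ((4 : ℤ) : ℤ⟦X⟧) * (Φ 1 * 1 + D 1 - 5 * 1) + (((-4 : ℤ) : ℤ⟦X⟧) * Φ 1 + 7 * 3) := by
    rw [D_one]; push_cast; ring
  rw [this]
  exact h

lemma M5_eq' : 60 * M5 = 5 * (-17 * G 4 + 8 * G 6 - 48 * Φ 1 * G 6 - 240 * Φ 3 * G 4 - 144 * Φ 5 * G 2)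
    - 864 * (Φ 1 * Φ 5) - 72 * D (Φ 5) + 36 * Φ 5 + 486 * Φ 1 := by
  apply int_cancel 7 (by norm_num)
  have h1 := M5_eq
  have h2 := G_eight
  have h3 := rel_three
  push_cast
  linear_combination 5 * h1 - 40 * h2 + 12 * h3

lemma Z_M5 : Z M5 := by
  obtain ⟨u, hu⟩ := mod_one
  obtain ⟨w, hw⟩ := mod_two
  have h4 := G_two
  have h5 := G_four
  have h6 := G_six
  have hm := M5_eq'
  have hD : D (6 * Φ 3 + Φ 3 ^ 2 + 4 * Φ 3 ^ 3 + 2 * Φ 3 ^ 4 + 3 * Φ 3 ^ 5 + Φ 3 ^ 6) =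
      (6 + 2 * Φ 3 + 12 * Φ 3 ^ 2 + 8 * Φ 3 ^ 3 + 15 * Φ 3 ^ 4 + 6 * Φ 3 ^ 5) * D (Φ 3) := by
    have hc (c : ℤ) (f : ℤ⟦X⟧) : D ((c : ℤ⟦X⟧) * f) = c * D f := D_intmul c f
    have h6 := hc 6
    have h4 := hc 4
    have h2 := hc 2
    have h3 := hc 3
    push_cast at h6 h4 h2 h3
    simp only [D_add, h6, h4, h2, h3, pow_succ, pow_zero, one_mul, D_mul]
    ring
  have hZ := Z_D (6 * Φ 3 + Φ 3 ^ 2 + 4 * Φ 3 ^ 3 + 2 * Φ 3 ^ 4 + 3 * Φ 3 ^ 5 + Φ 3 ^ 6)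
  rw [hD] at hZ
  have hZ5 := Z_D (Φ 5)
  rw [hu] at hZ hZ5 h4 h5 h6 hm
  rw [h4] at h5 h6 hm
  rw [h5] at h6 hm
  rw [h6] at hm
  rw [hw] at hZ
  clear hu hw h4 h5 h6 hD
  generalize Φ 3 = y at *
  generalize D (Φ 5) = g at *
  generalize Φ 5 = f at *
  have h60 := Z_add (Z_add (Z_int (-2) hZ5) hZ) (Z_seven ((-10) * g ^ 1 + (38) * f ^ 1 + (-6) * w ^ 1 + (486) * u ^ 1 + (-6622) * u ^ 1 * f ^ 1 + (-64260) * u ^ 2 + (6350400) * u ^ 3 + (-266716800) * u ^ 4 + (-946) * y ^ 1 * f ^ 1 + (-2) * y ^ 1 * w ^ 1 + (3234) * y ^ 1 * u ^ 1 + (907200) * y ^ 1 * u ^ 2 + (-152409600) * y ^ 1 * u ^ 3 + (813) * y ^ 2 + (-946) * y ^ 2 * f ^ 1 + (-12) * y ^ 2 * w ^ 1 + (-147961) * y ^ 2 * u ^ 1 + (-29937600) * y ^ 2 * u ^ 2 + (-152409600) * y ^ 2 * u ^ 3 + (-18051) * y ^ 3 + (-8) * y ^ 3 * w ^ 1 +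 (-2851204) * y ^ 3 * u ^ 1 + (-65318400) * y ^ 3 * u ^ 2 + (-130915) * y ^ 4 + (-15) * y ^ 4 * w ^ 1 + (-8942402) * y ^ 4 * u ^ 1 + (-32659200) * y ^ 4 * u ^ 2 + (-425830) * y ^ 5 + (-6) * y ^ 5 * w ^ 1 + (-9331203) * y ^ 5 * u ^ 1 + (-648004) * y ^ 6 + (-3110401) * y ^ 6 * u ^ 1 + (-444343) * y ^ 7 + (-111085) * y ^ 8))
  have h := Z_add (Z_int 2 h60) (Z_seven (-17 * M5))
  refine Eq.mp ?_ h
  congr 1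
  push_cast
  linear_combination -2 * hm

end SptSeven


namespace SptSeven

open PowerSeries Filter Topology
open scoped PowerSeries.WithPiTopology

/-- exponents -/
def ex (n k : ℕ) : ℕ := pentagonal ((n + 1 : ℕ) : ℤ) + (n + 1) * k

lemma ex_ge (n k c : ℕ) : n + k ≤ ex n (k + c) := by
  have := pent_ge (n + 1)
  unfold ex
  nlinarith [Nat.zero_le (n * k), Nat.zero_le (n * c)]

/-- odd moments of the half sums -/
noncomputable def AA (c j : ℕ) : ℤ⟦X⟧ :=
  ∑' i : ℕ × ℕ, (((-1) ^ (i.1 + 1) * (2 * ((i.2 : ℤ) + c) - 1) ^ j : ℤ) : ℤ⟦X⟧) * X ^ ex i.1 (i.2 + c)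

lemma AA_summable (c : ℕ) (a : ℕ × ℕ → ℤ) :
    Summable fun i : ℕ × ℕ => ((a i : ℤ) : ℤ⟦X⟧) * X ^ ex i.1 (i.2 + c) :=
  summ _ (fun i => i.1 + i.2) fin2 fun i => (pow_dvd_pow _ (ex_ge _ _ _)).mul_left _

lemma AA_hasSum (c j : ℕ) : HasSum (fun i : ℕ × ℕ => (((-1) ^ (i.1 + 1) * (2 * ((i.2 : ℤ) + c) - 1) ^ j : ℤ) : ℤ⟦X⟧) * X ^ ex i.1 (i.2 + c)) (AA c j) :=
  (AA_summable c _).hasSum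

lemma lt_eight (n k : ℕ) : 8 * lt (n + 1) k =
    (((-1) ^ (n + 1) : ℤ) : ℤ⟦X⟧) * X ^ ex n k * (24 * Φ 1 + ((24 * (ex n k : ℤ) + (2 * k - 1) ^ 2 - 1 : ℤ) : ℤ⟦X⟧)) := by
  unfold lt
  have h : 8 * T (3 * ((n + 1 : ℕ) : ℤ) + k) = 24 * (ex n k : ℤ) + (2 * k - 1) ^ 2 - 1 := by
    have h1 := two_T (3 * ((n + 1 : ℕ) : ℤ) + k)
    have h2 := two_pent (n + 1)
    unfold ex
    push_cast at *
    linear_combination 4 * h1 - 12 * h2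
  rw [← h]
  unfold ex
  push_cast
  ring

lemma H_moment (c : ℕ) : HasSum (fun k : ℕ => ((2 * ((k : ℤ) + c) - 1 : ℤ) : ℤ⟦X⟧) ^ 5 * H (k + c))
    (∑' i : ℕ × ℕ, ((2 * ((i.2 : ℤ) + c) - 1 : ℤ) : ℤ⟦X⟧) ^ 5 * lt (i.1 + 1) (i.2 + c)) ∧
    8 * (∑' i : ℕ × ℕ, ((2 * ((i.2 : ℤ) + c) - 1 : ℤ) : ℤ⟦X⟧) ^ 5 * lt (i.1 + 1) (i.2 + c)) =
      24 * (Φ 1 * AA c 5 + D (AA c 5)) + AA c 7 - AA c 5 := by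
  have hs : Summable fun i : ℕ × ℕ => ((2 * ((i.2 : ℤ) + c) - 1 : ℤ) : ℤ⟦X⟧) ^ 5 * lt (i.1 + 1) (i.2 + c) := by
    refine summ _ (fun i => i.1 + i.2) fin2 fun i => Dvd.dvd.mul_left ((pow_dvd_pow _ ?_).trans (lt_dvd _ _)) _
    nlinarith [Nat.zero_le (i.1 * i.2), Nat.zero_le (i.1 * c)]
  constructor
  · have hs' := (Equiv.prodComm ℕ ℕ).hasSum_iff.2 hs.hasSum
    have hs2 : HasSum (fun i : ℕ × ℕ => ((2 * ((i.1 : ℤ) + c) - 1 : ℤ) : ℤ⟦X⟧) ^ 5 * lt (i.2 + 1) (i.1 + c))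
      (∑' i : ℕ × ℕ, ((2 * ((i.2 : ℤ) + c) - 1 : ℤ) : ℤ⟦X⟧) ^ 5 * lt (i.1 + 1) (i.2 + c)) := hs'
    generalize (∑' i : ℕ × ℕ, ((2 * ((i.2 : ℤ) + c) - 1 : ℤ) : ℤ⟦X⟧) ^ 5 * lt (i.1 + 1) (i.2 + c)) = S0 at hs2
    refine hs2.prod_fiberwise (fun k => ?_)
    have h3 := ((lt_summable' (k + c)).hasSum).mul_left (((2 * ((k : ℤ) + c) - 1 : ℤ) : ℤ⟦X⟧) ^ 5)
    exact h3
  · have h1 := (((AA_hasSum c 5).mul_left (Φ 1)).add (hasSum_D (AA_hasSum c 5))).mul_left 24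
    have h2 := (h1.add (AA_hasSum c 7)).sub (AA_hasSum c 5)
    rw [← h2.tsum_eq, ← hs.tsum_mul_left]
    apply tsum_congr
    rintro ⟨n, k⟩
    have := lt_eight n (k + c)
    simp only
    rw [D_intmul, D_X_pow]
    push_cast at *
    linear_combination (2 * ((k : ℤ⟦X⟧) + c) - 1) ^ 5 * this

lemma H_moment' (c : ℕ) : ∃ S0 : ℤ⟦X⟧,
    HasSum (fun k : ℕ => ((2 * ((k : ℤ) + c) - 1 : ℤ) : ℤ⟦X⟧) ^ 5 * H (k + c)) S0 ∧
    8 * S0 = 24 * (Φ 1 * AA c 5 + D (AA c 5)) + AA c 7 - AA c 5 :=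
  ⟨_, (H_moment c).1, (H_moment c).2⟩

lemma ll_nat (k : ℕ) : (2 * (((k : ℕ) : ℤ) : ℤ⟦X⟧) - 1) ^ 5 * ll (k : ℤ) =
    ((2 * ((k : ℤ) + (0 : ℕ)) - 1 : ℤ) : ℤ⟦X⟧) ^ 5 * H (k + 0) := by
  simp only [ll]
  rw [if_pos (by omega), L_nat]
  push_cast
  ring

lemma ll_neg (k : ℕ) : (2 * ((-((k : ℤ) + 1) : ℤ) : ℤ⟦X⟧) - 1) ^ 5 * ll (-((k : ℤ) + 1)) =
    ((2 * ((k : ℤ) + (2 : ℕ)) - 1 : ℤ) : ℤ⟦X⟧) ^ 5 * H (k + 2) := by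
  simp only [ll]
  rw [if_neg (by omega), show -((k : ℤ) + 1) = -(k : ℤ) - 1 by ring, L_neg]
  push_cast
  ring

lemma M5_moment : 8 * M5 = 24 * (Φ 1 * (AA 0 5 + AA 2 5) + D (AA 0 5 + AA 2 5)) + (AA 0 7 + AA 2 7) -
    (AA 0 5 + AA 2 5) := by
  obtain ⟨S0, a0, b0⟩ := H_moment' 0
  obtain ⟨S2, a2, b2⟩ := H_moment' 2
  rw [← funext ll_nat] at a0
  rw [← funext ll_neg] at a2
  have h := HasSum.of_nat_of_neg_add_one (f := fun k : ℤ => (2 * (k : ℤ⟦X⟧) - 1) ^ 5 * ll k) a0 a2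
  have h' : M5 = S0 + S2 := h.tsum_eq
  rw [h', mul_add, b0, b2, D_add]
  ring

lemma AA_mod (c : ℕ) : ∃ u, AA c 7 = AA c 1 + 7 * u := by
  refine sum_mod (fun i : ℕ × ℕ => X ^ ex i.1 (i.2 + c)) (fun i => i.1 + i.2) fin2
    (fun i => pow_dvd_pow _ (ex_ge _ _ _)) _ _ fun i => ?_
  rw [← mul_sub, pow_one]
  exact (fermat _).mul_left _

lemma Z_A : Z (AA 0 1 + AA 2 1) := by
  obtain ⟨u, hu⟩ := AA_mod 0
  obtain ⟨v, hv⟩ := AA_mod 2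
  have h := Z_add (Z_add (Z_int 8 Z_M5) (Z_int (-24) (Z_D (AA 0 5 + AA 2 5))))
    (Z_seven (-17 * (AA 0 5 + AA 2 5) - u - v))
  refine Eq.mp ?_ h
  congr 1
  have := M5_moment
  push_cast
  linear_combination this + hu + hv

/-- the main series -/
noncomputable def Y : ℤ⟦X⟧ :=
  ∑' n : ℕ, (-1) ^ (n + 1) * X ^ (ex n 1) * (1 + X ^ (n + 1)) * K (n + 1) ^ 2

lemma Y_summable : Summable fun n : ℕ => (-1) ^ (n + 1) * X ^ (ex n 1) * (1 + X ^ (n + 1)) * K (n + 1) ^ 2 := by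
  refine summN _ fun n => ?_
  refine Dvd.dvd.mul_right (Dvd.dvd.mul_right (Dvd.dvd.mul_left (pow_dvd_pow _ ?_) _) _) _
  have := ex_ge n 1 0
  simp at this
  omega

lemma e_sum : HasSum (fun n : ℕ => (-1) ^ (n + 1) * X ^ (ex n 0) * (1 + X ^ (n + 1) : ℤ⟦X⟧)) (e - 1) := by
  have h1 := PowerSeries.WithPiTopology.hasSum_pow_pentagonal_sub_pentagonalSeries ℤ
  change HasSum _ e at h1
  have hb : Summable fun n : ℕ => (-1) ^ n * (X ^ pentagonal ((n : ℤ) + 1) : ℤ⟦X⟧) :=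
    summN _ fun n => Dvd.dvd.mul_left (pow_dvd_pow _ (by
      have := pent_ge (n + 1); push_cast at this; omega)) _
  have ha : Summable fun n : ℕ => (-1) ^ n * (X ^ pentagonal (-(n : ℤ)) : ℤ⟦X⟧) :=
    summN _ fun n => Dvd.dvd.mul_left (pow_dvd_pow _ (by
      rw [pent_neg]; omega)) _
  have h2 := ha.hasSum.sub hb.hasSum
  have h3 : e = (∑' (b : ℕ), (-1) ^ b * X ^ pentagonal (-(b : ℤ)) - ∑' (b : ℕ), (-1) ^ b * X ^ pentagonal ((b : ℤ) + 1)) := by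
    refine h1.unique ?_
    refine Eq.mp ?_ h2
    congr 1
    funext n
    ring
  rw [ha.tsum_eq_zero_add] at h3
  have ha' := (summable_nat_add_iff 1).2 ha
  have h4 := ha'.hasSum.sub hb.hasSum
  refine Eq.mp ?_ h4
  congr 1
  · funext n
    unfold ex
    rw [pent_neg]
    push_cast
    rw [pow_add, pow_succ (-1 : ℤ⟦X⟧)]
    ring
  · rw [h3]
    simp [pentagonal_def]
    ring

lemma geo (t : ℕ) (ht : t ≠ 0) : HasSum (fun k : ℕ => (X : ℤ⟦X⟧) ^ (t * k)) (K t) := by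
  have hs : Summable fun k : ℕ => (X : ℤ⟦X⟧) ^ (t * k) :=
    summN _ fun k => pow_dvd_pow _ (Nat.le_mul_of_pos_left k (by omega))
  have h3 := hs.tsum_eq_zero_add
  rw [(E_tsum ht).tsum_eq, mul_zero, pow_zero, ← K_eq ht] at h3
  rw [← h3]
  exact hs.hasSum

lemma geo' (t : ℕ) (ht : t ≠ 0) : HasSum (fun k : ℕ => (k : ℤ⟦X⟧) * X ^ (t * k)) (X ^ t * K t ^ 2) := by
  have h := geo t ht
  have hs : Summable fun k : ℕ => (k : ℤ⟦X⟧) * X ^ (t * k) :=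
    summN _ fun k => Dvd.dvd.mul_left (pow_dvd_pow _ (Nat.le_mul_of_pos_left k (by omega))) _
  have h3 := hs.tsum_eq_zero_add
  have h4 : HasSum (fun k : ℕ => ((k + 1 : ℕ) : ℤ⟦X⟧) * X ^ (t * (k + 1)))
     (X ^ t * (∑' k : ℕ, (k : ℤ⟦X⟧) * X ^ (t * k)) + X ^ t * K t) := by
    refine Eq.mp ?_ ((hs.hasSum.mul_left (X ^ t)).add (h.mul_left (X ^ t)))
    congr 1
    funext k
    push_cast
    ring
  rw [h4.tsum_eq] at h3
  have hK := K_mul ht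
  refine Eq.mp ?_ hs.hasSum
  congr 1
  simp only [Nat.cast_zero, zero_mul, zero_add] at h3
  linear_combination K t * h3 - (∑' k : ℕ, (k : ℤ⟦X⟧) * X ^ (t * k)) * hK

end SptSeven


namespace SptSeven

open PowerSeries Filter Topology
open scoped PowerSeries.WithPiTopology

lemma ex_add (n k c : ℕ) : ex n (k + c) = ex n c + (n + 1) * k := by
  unfold ex; ring

lemma AA_one (c : ℕ) : HasSum (fun n : ℕ => (-1) ^ (n + 1) * X ^ (ex n c) *
    (2 * (X ^ (n + 1) * K (n + 1) ^ 2) + (2 * (c : ℤ⟦X⟧) - 1) * K (n + 1))) (AA c 1) := by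
  have h := AA_hasSum c 1
  refine h.prod_fiberwise (fun n => ?_)
  have h1 := ((geo' (n + 1) (by omega)).mul_left 2).add
    ((geo (n + 1) (by omega)).mul_left (2 * (c : ℤ⟦X⟧) - 1))
  have h2 := h1.mul_left ((-1) ^ (n + 1) * X ^ (ex n c))
  refine Eq.mp ?_ h2
  congr 1
  funext k
  rw [ex_add, pow_add X]
  push_cast
  ring

lemma S_one : AA 0 1 + AA 2 1 = 2 * Y - (e - 1) := by
  have h1 := (AA_one 0).add (AA_one 2)
  have h2 := (Y_summable.hasSum.mul_left 2).sub e_sum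
  refine h1.unique (Eq.mp ?_ h2)
  congr 1
  funext n
  have hK := K_mul (t := n + 1) (by omega)
  have e1 : ex n 1 = ex n 0 + (n + 1) := by unfold ex; ring
  have e2 : ex n 2 = ex n 0 + (n + 1) + (n + 1) := by unfold ex; ring
  rw [e1, e2]
  simp only [pow_add X (ex n 0 + (n + 1)), pow_add X (ex n 0)]
  generalize (X : ℤ⟦X⟧) ^ (n + 1) = x at *
  push_cast
  linear_combination ((-1) ^ (n + 1) * X ^ (ex n 0)) * (2 * x ^ 2 * K (n + 1) + 1 + x) * hK

lemma Z_e : Z (e - 1) := by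
  intro n
  have h := Z_one n
  have h1 : pS * (e - 1) = 1 - pS * 1 := by linear_combination e_mul
  rw [h1, map_sub, coeff_one, if_neg (by omega), zero_sub]
  exact (dvd_neg.2 h)

lemma Z_Y : Z Y := by
  have h := Z_add (Z_int 4 (Z_add Z_A Z_e)) (Z_seven (-Y))
  rw [S_one] at h
  refine Eq.mp ?_ h
  congr 1
  push_cast
  ring

lemma Z_main : Z (Φ 1 + Y) := Z_add Z_Φ Z_Y

end SptSeven


namespace SptSeven

open PowerSeries Filter Topology
open scoped PowerSeries.WithPiTopology

/-! ### finite identities -/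

/-- `(q)_n` -/
noncomputable def q (n : ℕ) : ℤ⟦X⟧ := ∏ i ∈ Finset.range n, (1 - X ^ (i + 1))
/-- `1/(q)_n` -/
noncomputable def Q (n : ℕ) : ℤ⟦X⟧ := ∏ i ∈ Finset.range n, K (i + 1)

lemma q_succ (n : ℕ) : q (n + 1) = q n * (1 - X ^ (n + 1)) := Finset.prod_range_succ _ _
lemma Q_succ (n : ℕ) : Q (n + 1) = Q n * K (n + 1) := Finset.prod_range_succ _ _
lemma q_zero : q 0 = 1 := rfl
lemma Q_zero : Q 0 = 1 := rfl
lemma Q_succ' (n : ℕ) : Q n = Q (n + 1) * (1 - X ^ (n + 1)) := by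
  rw [Q_succ]; linear_combination (-Q n) * K_mul (t := n + 1) (by omega)
lemma qQ (n : ℕ) : q n * Q n = 1 := by
  unfold q Q
  rw [← Finset.prod_mul_distrib]
  exact Finset.prod_eq_one fun i _ => K_mul (by omega)

/-- `α_{r+1}` -/
noncomputable def al (r : ℕ) : ℤ⟦X⟧ := (-1) ^ (r + 1) * X ^ ex r 0 * (1 + X ^ (r + 1))

lemma ex_succ (s : ℕ) : ex (s + 1) 0 = ex s 0 + 3 * (s + 1) + 1 := by
  unfold ex
  rw [pent_succ (s + 1)]; ring

lemma bailey_aux (N s : ℕ) (hs : s ≤ N) :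
    ∑ r ∈ Finset.range s, ((1 - X ^ (N + 1)) * (al r * Q (N - r) * Q (N + 2 + r)) -
      al r * Q (N - (r + 1)) * Q (N + 1 + r)) =
    - X ^ (N + 1) * Q N * Q (N + 1) -
      (-1) ^ (s + 1) * X ^ (ex s 0 + (N - s)) * Q (N - s) * Q (N + 1 + s) := by
  induction s with
  | zero =>
    have : ex 0 0 = 1 := by simp [ex, pentagonal_def]
    rw [this]
    simp
    ring
  | succ s ih =>
    rw [Finset.sum_range_succ, ih (by omega)]
    obtain ⟨d, rfl⟩ : ∃ d, N = s + 1 + d := ⟨N - (s + 1), by omega⟩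
    have e1 : s + 1 + d - s = d + 1 := by omega
    have e2 : s + 1 + d - (s + 1) = d := by omega
    rw [e1, e2, ex_succ, Q_succ' d]
    have e3 : s + 1 + d + 1 + (s + 1) = s + 1 + d + 1 + s + 1 := by ring
    have e4 : s + 1 + d + 2 + s = s + 1 + d + 1 + s + 1 := by ring
    rw [e3, e4, Q_succ' (s + 1 + d + 1 + s)]
    unfold al
    generalize Q (s + 1 + d + 1 + s + 1) = A
    generalize Q (d + 1) = B
    ring

lemma bailey (n : ℕ) : Q n = Q n ^ 2 + ∑ r ∈ Finset.range n, al r * Q (n - (r + 1)) * Q (n + 1 + r) := by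
  induction n with
  | zero => simp [Q_zero]
  | succ N ih =>
    have h := bailey_aux N N le_rfl
    rw [Finset.sum_sub_distrib, ← Finset.mul_sum] at h
    rw [Finset.sum_range_succ]
    have e1 : ∀ r, N + 1 - (r + 1) = N - r := fun r => by omega
    have e2 : ∀ r, N + 1 + 1 + r = N + 2 + r := fun r => by omega
    simp only [e1, e2]
    have hK := K_mul (t := N + 1) (by omega)
    have h3 : Q (N + 1 + N) = Q (N + 2 + N) * (1 - X ^ (N + 1 + N + 1)) := by
      rw [Q_succ' (N + 1 + N)]
      congr 2
      ring
    have hq := Q_succ N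
    have hq' := Q_succ' N
    simp only [Nat.sub_self, Q_zero, mul_one, add_zero] at h ⊢
    rw [h3] at h
    unfold al at *
    generalize ∑ x ∈ Finset.range N, (-1) ^ (x + 1) * X ^ ex x 0 * (1 + X ^ (x + 1)) * Q (N - x) * Q (N + 2 + x) = S1 at *
    generalize ∑ x ∈ Finset.range N, (-1) ^ (x + 1) * X ^ ex x 0 * (1 + X ^ (x + 1)) * Q (N - (x + 1)) * Q (N + 1 + x) = S2 at *
    have h4 : (X : ℤ⟦X⟧) ^ (N + 1 + N + 1) = X ^ (N + 1) * X ^ (N + 1) := by ring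
    rw [h4] at h
    generalize (X : ℤ⟦X⟧) ^ (N + 1) = x at *
    generalize Q (N + 2 + N) = B at *
    -- (1 - x) * (goal)
    have h5 : (1 - x) * Q (N + 1) = (1 - x) * (Q (N + 1) ^ 2 + (S1 + (-1) ^ (N + 1) * X ^ ex N 0 * (1 + x) * B)) := by
      rw [hq'] at ih h
      linear_combination ih - h
    have h6 := congrArg (fun t => K (N + 1) * t) h5
    linear_combination h6 - (Q (N + 1) - (Q (N + 1) ^ 2 + (S1 + (-1) ^ (N + 1) * X ^ ex N 0 * (1 + x) * B))) * hK

lemma Ib (m d : ℕ) : ∑ i ∈ Finset.range (d + 1), q (m + i) ^ 2 * X ^ (m + 1 + i) * Q i * Q (m + 1 + (m + 1) + i) =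
    X ^ (m + 1) * K (m + 1) ^ 2 * q (m + 1 + d) ^ 2 * Q d * Q (m + 1 + (m + 1) + d) := by
  have hK := K_mul (t := m + 1) (by omega)
  induction d with
  | zero =>
    simp only [zero_add, Finset.sum_range_one, add_zero, q_succ, Q_zero]
    linear_combination (- q m ^ 2 * X ^ (m + 1) * Q (m + 1 + (m + 1))) * ((1 - X ^ (m + 1)) * K (m + 1) + 1) * hK
  | succ d ih =>
    rw [Finset.sum_range_succ, ih, Q_succ' d]
    have e1 : m + (d + 1) = m + 1 + d := by ring
    rw [e1, ← add_assoc (m + 1 + (m + 1)) d 1, Q_succ' (m + 1 + (m + 1) + d), ← add_assoc (m + 1) d 1, q_succ (m + 1 + d)]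
    have e2 : (X : ℤ⟦X⟧) ^ (m + 1 + (m + 1) + d + 1) = X ^ (m + 1) * X ^ (m + 1) * X ^ (d + 1) := by ring
    have e3 : (X : ℤ⟦X⟧) ^ (m + 1 + d + 1) = X ^ (m + 1) * X ^ (d + 1) := by ring
    rw [e2, e3]
    generalize (X : ℤ⟦X⟧) ^ (m + 1) = x at *
    generalize (X : ℤ⟦X⟧) ^ (d + 1) = z at *
    generalize Q (m + 1 + (m + 1) + d + 1) = A
    generalize Q (d + 1) = B
    generalize q (m + 1 + d) = C
    linear_combination (- C ^ 2 * x * z * A * B) * ((1 - x) * K (m + 1) + 1) * hK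

end SptSeven


namespace SptSeven

open PowerSeries Filter Topology
open scoped PowerSeries.WithPiTopology

lemma term_n (n : ℕ) : X ^ (n + 1) * q n * K (n + 1) = X ^ (n + 1) * K (n + 1) ^ 2 +
    ∑ r ∈ Finset.range (n + 1), al r * (q (r + (n - r)) ^ 2 * X ^ (r + 1 + (n - r)) * Q (n - r) *
      Q (r + 1 + (r + 1) + (n - r))) := by
  have h := bailey (n + 1)
  have h1 : ∑ r ∈ Finset.range (n + 1), al r * (q (r + (n - r)) ^ 2 * X ^ (r + 1 + (n - r)) * Q (n - r) *
      Q (r + 1 + (r + 1) + (n - r))) = q n ^ 2 * X ^ (n + 1) *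
      ∑ r ∈ Finset.range (n + 1), al r * Q (n + 1 - (r + 1)) * Q (n + 1 + 1 + r) := by
    rw [Finset.mul_sum]
    refine Finset.sum_congr rfl fun r hr => ?_
    rw [Finset.mem_range] at hr
    have e1 : r + (n - r) = n := by omega
    have e2 : r + 1 + (n - r) = n + 1 := by omega
    have e3 : r + 1 + (r + 1) + (n - r) = n + 1 + 1 + r := by omega
    have e4 : n + 1 - (r + 1) = n - r := by omega
    rw [e1, e2, e3, e4]
    ring
  rw [h1]
  have h2 := qQ n
  have h3 := Q_succ n
  generalize ∑ r ∈ Finset.range (n + 1), al r * Q (n + 1 - (r + 1)) * Q (n + 1 + 1 + r) = S at *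
  rw [h3] at h
  linear_combination (q n ^ 2 * X ^ (n + 1)) * h - (X ^ (n + 1) * q n * K (n + 1)) * h2 +
    (X ^ (n + 1) * K (n + 1) ^ 2 * (q n * Q n + 1)) * h2

lemma finId_aux (N : ℕ) : ∑ n ∈ Finset.range N, X ^ (n + 1) * q n * K (n + 1) =
    ∑ n ∈ Finset.range N, X ^ (n + 1) * K (n + 1) ^ 2 +
    ∑ r ∈ Finset.range N, al r * ∑ i ∈ Finset.range (N - r), (q (r + i) ^ 2 * X ^ (r + 1 + i) * Q i *
      Q (r + 1 + (r + 1) + i)) := by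
  induction N with
  | zero => simp
  | succ N ih =>
    have h : ∑ r ∈ Finset.range (N + 1), al r * ∑ i ∈ Finset.range (N + 1 - r), (q (r + i) ^ 2 * X ^ (r + 1 + i) * Q i *
        Q (r + 1 + (r + 1) + i)) =
      ∑ r ∈ Finset.range (N + 1), al r * ∑ i ∈ Finset.range (N - r), (q (r + i) ^ 2 * X ^ (r + 1 + i) * Q i *
        Q (r + 1 + (r + 1) + i)) +
      ∑ r ∈ Finset.range (N + 1), al r * (q (r + (N - r)) ^ 2 * X ^ (r + 1 + (N - r)) * Q (N - r) *
      Q (r + 1 + (r + 1) + (N - r))) := by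
      rw [← Finset.sum_add_distrib]
      refine Finset.sum_congr rfl fun r hr => ?_
      rw [Finset.mem_range] at hr
      have e1 : N + 1 - r = N - r + 1 := by omega
      rw [e1, Finset.sum_range_succ, mul_add]
    rw [h, Finset.sum_range_succ, ih, term_n, Finset.sum_range_succ (fun n => X ^ (n + 1) * K (n + 1) ^ 2),
      Finset.sum_range_succ (fun r => al r * ∑ i ∈ Finset.range (N - r), (q (r + i) ^ 2 * X ^ (r + 1 + i) * Q i *
        Q (r + 1 + (r + 1) + i)))]
    simp only [Nat.sub_self, Finset.range_zero, Finset.sum_empty, mul_zero, add_zero]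
    ring

lemma finId (N : ℕ) : ∑ n ∈ Finset.range N, X ^ (n + 1) * q n * K (n + 1) =
    ∑ n ∈ Finset.range N, X ^ (n + 1) * K (n + 1) ^ 2 +
    ∑ r ∈ Finset.range N, al r * X ^ (r + 1) * K (r + 1) ^ 2 * (q N ^ 2 * Q (N - (r + 1)) * Q (N + (r + 1))) := by
  rw [finId_aux]
  congr 1
  refine Finset.sum_congr rfl fun r hr => ?_
  rw [Finset.mem_range] at hr
  obtain ⟨d, rfl⟩ : ∃ d, N = r + 1 + d := ⟨N - (r + 1), by omega⟩
  have e1 : r + 1 + d - r = d + 1 := by omega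
  have e2 : r + 1 + d - (r + 1) = d := by omega
  have e3 : r + 1 + (r + 1) + d = r + 1 + d + (r + 1) := by omega
  rw [e1, e2, Ib, e3]
  ring

lemma qQ1 (a b : ℕ) : X ^ (a + 1) ∣ q (a + b) * Q a - 1 := by
  induction b with
  | zero => rw [add_zero, qQ]; simp
  | succ b ih =>
    rw [← add_assoc, q_succ]
    have : q (a + b) * (1 - X ^ (a + b + 1)) * Q a - 1 = (q (a + b) * Q a - 1) -
      X ^ (a + 1) * (X ^ b * q (a + b) * Q a) := by ring
    rw [this]
    exact dvd_sub ih (Dvd.intro _ rfl)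

lemma qQ2 (a b : ℕ) : X ^ (a + 1) ∣ q a * Q (a + b) - 1 := by
  have h : q a * Q (a + b) - 1 = (q (a + b) * Q a - 1) * (- q a * Q (a + b)) := by
    linear_combination (q (a + b) * Q (a + b)) * qQ a + qQ (a + b)
  rw [h]
  exact (qQ1 a b).mul_right _

lemma r_dvd (N r : ℕ) (hr : r < N) : X ^ (N + 1) ∣
    al r * X ^ (r + 1) * K (r + 1) ^ 2 * (q N ^ 2 * Q (N - (r + 1)) * Q (N + (r + 1))) -
    (-1) ^ (r + 1) * X ^ (ex r 1) * (1 + X ^ (r + 1)) * K (r + 1) ^ 2 := by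
  obtain ⟨d, rfl⟩ : ∃ d, N = d + (r + 1) := ⟨N - (r + 1), by omega⟩
  have e1 : d + (r + 1) - (r + 1) = d := by omega
  have e2 : ex r 1 = ex r 0 + (r + 1) := by unfold ex; ring
  rw [e1, e2]
  obtain ⟨A, hA⟩ := qQ1 d (r + 1)
  obtain ⟨B, hB⟩ := qQ2 (d + (r + 1)) (r + 1)
  unfold al
  have e3 : (X : ℤ⟦X⟧) ^ (d + (r + 1) + 1) = X ^ (r + 1) * X ^ (d + 1) := by ring
  rw [e3] at hB ⊢
  refine ⟨(-1) ^ (r + 1) * X ^ ex r 0 * (1 + X ^ (r + 1)) * K (r + 1) ^ 2 *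
    (A * (q (d + (r + 1)) * Q (d + (r + 1) + (r + 1))) + X ^ (r + 1) * B), ?_⟩
  rw [pow_add X (ex r 0)]
  generalize (X : ℤ⟦X⟧) ^ (r + 1) = x at *
  linear_combination ((-1) ^ (r + 1) * X ^ ex r 0 * (1 + x) * K (r + 1) ^ 2 * x) *
    ((q (d + (r + 1)) * Q (d + (r + 1) + (r + 1))) * hA + hB)

lemma tail_dvd {f : ℕ → ℤ⟦X⟧} (h : ∀ n, X ^ (n + 1) ∣ f n) (N : ℕ) :
    X ^ (N + 1) ∣ ∑' n, f n - ∑ n ∈ Finset.range N, f n := by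
  have hs : Summable f := summN f fun i => (pow_dvd_pow _ (by omega)).trans (h i)
  rw [← hs.sum_add_tsum_nat_add N, add_sub_cancel_left]
  exact dvd_tsum fun i => (pow_dvd_pow _ (by omega)).trans (h (i + N))

/-- left side -/
noncomputable def LL : ℤ⟦X⟧ := ∑' n : ℕ, X ^ (n + 1) * q n * K (n + 1)

lemma Phi_one : Φ 1 = ∑' n : ℕ, X ^ (n + 1) * K (n + 1) ^ 2 := by
  have h := (Equiv.prodComm ℕ ℕ).hasSum_iff.2 (Φ_dbl 1)
  generalize Φ 1 = P at h
  have h2 := h.prod_fiberwise (g := fun n : ℕ => X ^ (n + 1) * K (n + 1) ^ 2) (fun n => ?_)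
  · exact h2.tsum_eq.symm
  · have h4 := geo' (n + 1) (by omega)
    rw [← hasSum_nat_add_iff' 1] at h4
    simp only [Finset.sum_range_one, Nat.cast_zero, zero_mul, sub_zero] at h4
    refine Eq.mp ?_ h4
    congr 1
    funext k
    simp only [Function.comp, Equiv.prodComm_apply, Prod.swap]
    push_cast
    ring

lemma LL_eq : LL = Φ 1 + Y := by
  have key : ∀ N, X ^ (N + 1) ∣ LL - (Φ 1 + Y) := by
    intro N
    have h1 : X ^ (N + 1) ∣ LL - ∑ n ∈ Finset.range N, X ^ (n + 1) * q n * K (n + 1) :=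
      tail_dvd (fun n => ⟨q n * K (n + 1), by ring⟩) N
    have h2 : X ^ (N + 1) ∣ Φ 1 - ∑ n ∈ Finset.range N, X ^ (n + 1) * K (n + 1) ^ 2 := by
      rw [Phi_one]
      exact tail_dvd (fun n => ⟨K (n + 1) ^ 2, by ring⟩) N
    have h3 : X ^ (N + 1) ∣ Y - ∑ n ∈ Finset.range N, (-1) ^ (n + 1) * X ^ (ex n 1) * (1 + X ^ (n + 1)) * K (n + 1) ^ 2 := by
      refine tail_dvd (fun n => ⟨(-1) ^ (n + 1) * X ^ (ex n 0) * (1 + X ^ (n + 1)) * K (n + 1) ^ 2, ?_⟩) N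
      have e2 : ex n 1 = ex n 0 + (n + 1) := by unfold ex; ring
      rw [e2]; ring
    have h4 : X ^ (N + 1) ∣ ∑ r ∈ Finset.range N, al r * X ^ (r + 1) * K (r + 1) ^ 2 * (q N ^ 2 * Q (N - (r + 1)) * Q (N + (r + 1))) -
      ∑ n ∈ Finset.range N, (-1) ^ (n + 1) * X ^ (ex n 1) * (1 + X ^ (n + 1)) * K (n + 1) ^ 2 := by
      rw [← Finset.sum_sub_distrib]
      exact Finset.dvd_sum fun r hr => r_dvd N r (Finset.mem_range.1 hr)
    rw [finId] at h1
    have h5 := dvd_add (dvd_sub (dvd_sub h1 h2) h3) h4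
    refine h5.trans (dvd_of_eq ?_)
    ring
  have : LL - (Φ 1 + Y) = 0 := by
    ext d
    rw [X_pow_dvd_iff.1 (key d) d (by omega)]; simp
  exact sub_eq_zero.1 this

lemma Z_LL : Z LL := LL_eq ▸ Z_main

end SptSeven


namespace SptSeven

open PowerSeries Filter Topology
open scoped PowerSeries.WithPiTopology

/-! ### combinatorics -/

/-- the local factor -/
noncomputable def lf (f : ℕ → ℕ → ℤ) (i : ℕ) : ℤ⟦X⟧ :=
  1 + ∑' j, f (i + 1) (j + 1) • X ^ ((i + 1) * (j + 1))

lemma genFun_e (f : ℕ → ℕ → ℤ) (M : ℕ) (h : ∀ i, M ≤ i → lf f i = K (i + 1)) :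
    Nat.Partition.genFun f * e = q M * ∏ i ∈ Finset.range M, lf f i := by
  have h1 : Tendsto (fun n => ∏ i ∈ Finset.range n, lf f i) atTop (𝓝 (Nat.Partition.genFun f)) :=
    (Nat.Partition.hasProd_genFun f).tendsto_prod_nat
  have h2 := h1.mul tendsto_prod_e
  refine tendsto_nhds_unique h2 ?_
  refine tendsto_const_nhds.congr' ?_
  filter_upwards [eventually_ge_atTop M] with n hn
  obtain ⟨d, rfl⟩ : ∃ d, n = M + d := ⟨n - M, by omega⟩
  clear hn
  induction d with
  | zero => rw [add_zero, mul_comm]; rfl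
  | succ d ih =>
    rw [← add_assoc, Finset.prod_range_succ, Finset.prod_range_succ, ih, h (M + d) (by omega)]
    linear_combination (-(∏ i ∈ Finset.range (M + d), lf f i) * (∏ i ∈ Finset.range (M + d), (1 - X ^ (i + 1)))) *
      K_mul (t := M + d + 1) (by omega)

/-- weights -/
def f0 (m i _c : ℕ) : ℤ := if i ≤ m then 0 else 1
/-- weights -/
def f1 (m i c : ℕ) : ℤ := if i < m then 0 else if i = m then (c : ℤ) else 1

lemma lf_one (f : ℕ → ℕ → ℤ) (i : ℕ) (h : ∀ j, f (i + 1) j = 1) : lf f i = K (i + 1) := by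
  unfold lf
  simp only [h, one_smul]
  rw [(E_tsum (t := i + 1) (by omega)).tsum_eq, K_eq (by omega)]

lemma lf_zero (f : ℕ → ℕ → ℤ) (i : ℕ) (h : ∀ j, f (i + 1) j = 0) : lf f i = 1 := by
  unfold lf
  simp [h]

lemma lf_mid (f : ℕ → ℕ → ℤ) (i : ℕ) (h : ∀ j, f (i + 1) j = (j : ℤ)) :
    lf f i = 1 + X ^ (i + 1) * K (i + 1) ^ 2 := by
  unfold lf
  congr 1
  have h4 := geo' (i + 1) (by omega)
  rw [← hasSum_nat_add_iff' 1] at h4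
  simp only [Finset.sum_range_one, Nat.cast_zero, zero_mul, sub_zero] at h4
  rw [← h4.tsum_eq]
  refine tsum_congr fun j => ?_
  rw [h, zsmul_eq_mul]
  push_cast
  ring

lemma gen_f0 (m : ℕ) : Nat.Partition.genFun (f0 (m + 1)) * e = q (m + 1) := by
  rw [genFun_e _ (m + 1), Finset.prod_eq_one, mul_one]
  · intro i hi
    rw [Finset.mem_range] at hi
    exact lf_zero _ _ fun j => if_pos (by omega)
  · intro i hi
    exact lf_one _ _ fun j => if_neg (by omega)

lemma gen_f1 (m : ℕ) : Nat.Partition.genFun (f1 (m + 1)) * e =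
    q (m + 1) * (1 + X ^ (m + 1) * K (m + 1) ^ 2) := by
  rw [genFun_e _ (m + 1), Finset.prod_range_succ, Finset.prod_eq_one, one_mul, lf_mid]
  · intro j
    simp [f1]
  · intro i hi
    rw [Finset.mem_range] at hi
    exact lf_zero _ _ fun j => if_pos (by omega)
  · intro i hi
    refine lf_one _ _ fun j => ?_
    unfold f1
    rw [if_neg (by omega), if_neg (by omega)]

lemma gen_diff (m : ℕ) : Nat.Partition.genFun (f1 (m + 1)) - Nat.Partition.genFun (f0 (m + 1)) =
    pS * (X ^ (m + 1) * q m * K (m + 1)) := by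
  have h0 := gen_f0 m
  have h1 := gen_f1 m
  have he := e_mul
  have hK := K_mul (t := m + 1) (by omega)
  rw [q_succ] at h0 h1
  generalize Nat.Partition.genFun (f1 (m + 1)) = A at *
  generalize Nat.Partition.genFun (f0 (m + 1)) = B at *
  linear_combination pS * (h1 - h0) - (A - B) * he + (pS * q m * X ^ (m + 1) * K (m + 1)) * hK

lemma weight (m N : ℕ) (P : Nat.Partition N) :
    P.parts.toFinsupp.prod (f1 m) - P.parts.toFinsupp.prod (f0 m) =
      (Multiset.count m (P.parts.filter (fun a => ∀ b ∈ P.parts, a ≤ b)) : ℤ) := by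
  simp only [Finsupp.prod, Multiset.toFinsupp_support, Multiset.toFinsupp_apply, Multiset.count_filter]
  generalize P.parts = s
  split_ifs with h
  · by_cases hm : m ∈ s
    · rw [Finset.prod_eq_single m, Finset.prod_eq_zero (i := m)]
      · simp [f1]
      · simpa using hm
      · simp [f0]
      · intro b hb hbm
        have := h b (by simpa using hb)
        unfold f1
        rw [if_neg (by omega), if_neg hbm]
      · intro h'
        exact absurd (by simpa using hm) h'
    · rw [Multiset.count_eq_zero_of_notMem hm]
      rw [Finset.prod_eq_one, Finset.prod_eq_one]
      · simp
      · intro b hb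
        have hb' : b ∈ s := by simpa using hb
        have := h b hb'
        have : b ≠ m := fun h => hm (h ▸ hb')
        exact if_neg (by omega)
      · intro b hb
        have hb' : b ∈ s := by simpa using hb
        have := h b hb'
        have : b ≠ m := fun h => hm (h ▸ hb')
        unfold f1
        rw [if_neg (by omega), if_neg (by omega)]
  · push Not at h
    obtain ⟨b, hb, hbm⟩ := h
    have hb' : b ∈ s.toFinset := by simpa using hb
    rw [Finset.prod_eq_zero hb', Finset.prod_eq_zero hb']
    · simp
    · exact if_pos (by omega)
    · exact if_pos hbm

lemma spt_eq (N : ℕ) : (spt N : ℤ) = coeff N (pS * LL) := by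
  have h1 : X ^ (N + 1) ∣ LL - ∑ n ∈ Finset.range N, X ^ (n + 1) * q n * K (n + 1) :=
    tail_dvd (fun n => ⟨q n * K (n + 1), by ring⟩) N
  have h2 := X_pow_dvd_iff.1 (h1.mul_left pS) N (by omega)
  rw [mul_sub, map_sub, sub_eq_zero] at h2
  rw [h2, Finset.mul_sum, map_sum]
  simp only [← gen_diff, map_sub, Nat.Partition.coeff_genFun]
  simp only [← Finset.sum_sub_distrib, weight]
  rw [Finset.sum_comm]
  unfold spt
  rw [Nat.cast_sum]
  refine Finset.sum_congr rfl fun P _ => ?_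
  rw [← Nat.cast_sum]
  congr 1
  rw [← Multiset.sum_count_eq_card (s := (Finset.range N).map (addRightEmbedding 1))]
  · rw [Finset.sum_map]; rfl
  · intro a ha
    have ha' := Multiset.mem_of_mem_filter ha
    have h3 := P.parts_pos ha'
    have h4 : a ≤ N := by
      have := Multiset.le_sum_of_mem ha'
      rwa [P.parts_sum] at this
    simp only [Finset.mem_map, Finset.mem_range, addRightEmbedding_apply]
    exact ⟨a - 1, by omega, by omega⟩

end SptSeven

/-- Andrews' congruence: `spt(7n+5) ≡ 0 (mod 7)`. -/
theorem spt_congr_seven (n : ℕ) : spt (7 * n + 5) ≡ 0 [MOD 7] := by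
  have h := SptSeven.Z_LL n
  rw [← SptSeven.spt_eq] at h
  exact (Nat.modEq_zero_iff_dvd).2 (by exact_mod_cast h)
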